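/- (Thermal fluctuations of 𝓛) For n large enough, for all positive real numbers a < b, all t ∈ [0,1] and all R_v ∈ [0,∞), the thermal fluctuations of 𝓛 in the (t,R)-parametrized model satisfy ∫_a^b E⟨ (𝓛 − ⟨𝓛⟩_{t,(R_u,R_v)})² ⟩_{t,(R_u,R_v)} dR_u ≤ (α_u α_v ρ_v / n) ( ln(b/a)/2 + 1 ). -/

import Mathlib

open MeasureTheory Real Filter Set

noncomputable section

/-- i.i.d. standard Gaussian measure on `Fin n → ℝ`. -/
def stdGaussian (n : ℕ) : Measure (Fin n → ℝ) :=
  Measure.pi fun _ : Fin n => ProbabilityTheory.gaussianReal 0 1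

/-- i.i.d. standard Gaussian measure on matrices `Fin p → Fin q → ℝ`. -/
def stdGaussianMat (p q : ℕ) : Measure (Fin p → Fin q → ℝ) :=
  Measure.pi fun _ : Fin p => stdGaussian q

/-- `P` is the uniform (rotation-invariant) probability measure on the sphere of
radius `r` centered at the origin in `ℝⁿ`. -/
def IsUniformSphere (n : ℕ) (r : ℝ) (P : Measure (Fin n → ℝ)) : Prop :=
  IsProbabilityMeasure P ∧
  (∀ᵐ x ∂P, ∑ i, (x i) ^ 2 = r ^ 2) ∧
  ∀ O : Matrix (Fin n) (Fin n) ℝ, O ∈ Matrix.orthogonalGroup (Fin n) ℝ →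
    P.map (fun x => O.mulVec x) = P

/-- The interpolating Hamiltonian `H_{t,R}(u,v)`, with the observations
`Y^{(t)} = √((1−t)/n) U Vᵀ + Z`, `Ỹ = √(α_v R_v) U + Z̃`, `Ȳ = √(α_u R_u) V + Z̄`
substituted. -/
def interpH (n nu nv : ℕ) (au av t Ru Rv : ℝ)
    (U : Fin nu → ℝ) (V : Fin nv → ℝ) (Z : Fin nu → Fin nv → ℝ)
    (Zt : Fin nu → ℝ) (Zb : Fin nv → ℝ)
    (u : Fin nu → ℝ) (v : Fin nv → ℝ) : ℝ :=
  (∑ i, ∑ j, ((1 - t) / (2 * n) * (u i) ^ 2 * (v j) ^ 2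
      - Real.sqrt ((1 - t) / n) * u i * v j
          * (Real.sqrt ((1 - t) / n) * U i * V j + Z i j)))
  + (∑ i, (av * Rv / 2 * (u i) ^ 2
      - Real.sqrt (av * Rv) * u i * (Real.sqrt (av * Rv) * U i + Zt i)))
  + (∑ j, (au * Ru / 2 * (v j) ^ 2
      - Real.sqrt (au * Ru) * v j * (Real.sqrt (au * Ru) * V j + Zb j)))

/-- The partition function `Z_{t,R} = ∫∫ e^{−H_{t,R}(u,v)} dP_u(u) dP_v(v)`. -/
def partFun (n nu nv : ℕ) (au av t Ru Rv : ℝ)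
    (Pu : Measure (Fin nu → ℝ)) (Pv : Measure (Fin nv → ℝ))
    (U : Fin nu → ℝ) (V : Fin nv → ℝ) (Z : Fin nu → Fin nv → ℝ)
    (Zt : Fin nu → ℝ) (Zb : Fin nv → ℝ) : ℝ :=
  ∫ u, (∫ v, Real.exp (-(interpH n nu nv au av t Ru Rv U V Z Zt Zb u v)) ∂Pv) ∂Pu

/-- The Gibbs bracket `⟨f⟩_{t,R}`, i.e. the expectation of `f(u,v)` under the
posterior measure proportional to `e^{−H_{t,R}(u,v)} dP_u(u) dP_v(v)`. -/
def gibbs (n nu nv : ℕ) (au av t Ru Rv : ℝ)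
    (Pu : Measure (Fin nu → ℝ)) (Pv : Measure (Fin nv → ℝ))
    (U : Fin nu → ℝ) (V : Fin nv → ℝ) (Z : Fin nu → Fin nv → ℝ)
    (Zt : Fin nu → ℝ) (Zb : Fin nv → ℝ)
    (f : (Fin nu → ℝ) → (Fin nv → ℝ) → ℝ) : ℝ :=
  (∫ u, (∫ v, f u v * Real.exp (-(interpH n nu nv au av t Ru Rv U V Z Zt Zb u v)) ∂Pv) ∂Pu)
    / partFun n nu nv au av t Ru Rv Pu Pv U V Z Zt Zb

/-- Expectation `E` over all the randomness `U ~ P_u`, `V ~ P_v` and the independent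
standard Gaussian noises `Z, Z̃, Z̄`. -/
def Efull (nu nv : ℕ)
    (Pu : Measure (Fin nu → ℝ)) (Pv : Measure (Fin nv → ℝ))
    (g : (Fin nu → ℝ) → (Fin nv → ℝ) → (Fin nu → Fin nv → ℝ) →
      (Fin nu → ℝ) → (Fin nv → ℝ) → ℝ) : ℝ :=
  ∫ U, (∫ V, (∫ Z, (∫ Zt, (∫ Zb, g U V Z Zt Zb
    ∂(stdGaussian nv)) ∂(stdGaussian nu)) ∂(stdGaussianMat nu nv)) ∂Pv) ∂Pu

/-- The average interpolating free entropy `fₙ(t,R) = (1/n) E ln Z_{t,R}`. -/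
def interpFreeEntropy (n nu nv : ℕ) (au av t Ru Rv : ℝ)
    (Pu : Measure (Fin nu → ℝ)) (Pv : Measure (Fin nv → ℝ)) : ℝ :=
  (1 / (n : ℝ)) * Efull nu nv Pu Pv (fun U V Z Zt Zb =>
    Real.log (partFun n nu nv au av t Ru Rv Pu Pv U V Z Zt Zb))

/-- The overlap `Q_u = (1/n_u) Σ_i u_i U_i`. -/
def overlapU (nu : ℕ) (u U : Fin nu → ℝ) : ℝ := (1 / (nu : ℝ)) * ∑ i, u i * U i

/-- The overlap `Q_v = (1/n_v) Σ_j v_j V_j`. -/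
def overlapV (nv : ℕ) (v V : Fin nv → ℝ) : ℝ := (1 / (nv : ℝ)) * ∑ j, v j * V j

/-- `E⟨Q_v⟩_{t,R}`. -/
def eQv (n nu nv : ℕ) (au av t Ru Rv : ℝ)
    (Pu : Measure (Fin nu → ℝ)) (Pv : Measure (Fin nv → ℝ)) : ℝ :=
  Efull nu nv Pu Pv (fun U V Z Zt Zb =>
    gibbs n nu nv au av t Ru Rv Pu Pv U V Z Zt Zb (fun _ v => overlapV nv v V))

/-- `E⟨Q_u⟩_{t,R}`. -/
def eQu (n nu nv : ℕ) (au av t Ru Rv : ℝ)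
    (Pu : Measure (Fin nu → ℝ)) (Pv : Measure (Fin nv → ℝ)) : ℝ :=
  Efull nu nv Pu Pv (fun U V Z Zt Zb =>
    gibbs n nu nv au av t Ru Rv Pu Pv U V Z Zt Zb (fun u _ => overlapU nu u U))

/-- The quantity `𝓛 = (1/n) Σ_j [(α_u/2)v_j² − α_u v_j V_j − (1/2)√(α_u/R_u) v_j Z̄_j]`. -/
def calL (n nv : ℕ) (au Ru : ℝ) (v V Zb : Fin nv → ℝ) : ℝ :=
  (1 / (n : ℝ)) * ∑ j, (au / 2 * (v j) ^ 2 - au * v j * V j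
    - 1 / 2 * Real.sqrt (au / Ru) * v j * Zb j)

/-- `E⟨𝓛⟩_{t,R}`. -/
def eL (n nu nv : ℕ) (au av t Ru Rv : ℝ)
    (Pu : Measure (Fin nu → ℝ)) (Pv : Measure (Fin nv → ℝ)) : ℝ :=
  Efull nu nv Pu Pv (fun U V Z Zt Zb =>
    gibbs n nu nv au av t Ru Rv Pu Pv U V Z Zt Zb (fun _ v => calL n nv au Ru v V Zb))

/-- `φ₀(m) = (m − ln(1+m))/2`. -/
def phi0 (m : ℝ) : ℝ := (m - Real.log (1 + m)) / 2


/-- The thermal variance of `𝓛` : `E⟨(𝓛 − ⟨𝓛⟩)²⟩_{t,R}`. -/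
def thermalVarL (n nu nv : ℕ) (au av t Ru Rv : ℝ)
    (Pu : Measure (Fin nu → ℝ)) (Pv : Measure (Fin nv → ℝ)) : ℝ :=
  Efull nu nv Pu Pv (fun U V Z Zt Zb =>
    gibbs n nu nv au av t Ru Rv Pu Pv U V Z Zt Zb (fun _ v =>
      (calL n nv au Ru v V Zb
        - gibbs n nu nv au av t Ru Rv Pu Pv U V Z Zt Zb
            (fun _ v' => calL n nv au Ru v' V Zb)) ^ 2))

/-- The law of `s + z`, `z ∼ γ`, has density `exp φ` with respect to `γ`. -/
structure HasShiftLogDensity {E : Type*} [MeasurableSpace E] [Add E]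
    (γ : Measure E) (s : E) (φ : E → ℝ) : Prop where
  measurable : Measurable φ
  map_eq : γ.map (fun z => s + z) = γ.withDensity fun y => ENNReal.ofReal (exp (φ y))

lemma hasShiftLogDensity_gaussianReal (s : ℝ) :
    HasShiftLogDensity (ProbabilityTheory.gaussianReal 0 1) s (fun y => s * y - s ^ 2 / 2) := by
  refine ⟨by fun_prop, ?_⟩
  rw [ProbabilityTheory.gaussianReal_map_const_add, zero_add,
    ProbabilityTheory.gaussianReal_of_var_ne_zero _ one_ne_zero,
    ProbabilityTheory.gaussianReal_of_var_ne_zero _ one_ne_zero,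
    ← withDensity_mul _ (ProbabilityTheory.measurable_gaussianPDF _ _) (by fun_prop)]
  congr 1
  ext y
  simp only [ProbabilityTheory.gaussianPDF, Pi.mul_apply]
  rw [← ENNReal.ofReal_mul (ProbabilityTheory.gaussianPDFReal_nonneg _ _ _)]
  congr 1
  simp only [ProbabilityTheory.gaussianPDFReal]
  rw [mul_assoc (√(2 * π * _))⁻¹, ← exp_add]
  congr 2
  simp only [NNReal.coe_one]
  ring

lemma HasShiftLogDensity.integrable_exp {E : Type*} [MeasurableSpace E] [Add E] [MeasurableAdd E]
    {γ : Measure E} [IsFiniteMeasure γ] {s : E} {φ : E → ℝ} (h : HasShiftLogDensity γ s φ) :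
    Integrable (fun y => exp (φ y)) γ := by
  have hm := h.measurable
  refine ⟨by fun_prop, ?_⟩
  rw [hasFiniteIntegral_iff_ofReal (ae_of_all _ fun y => (exp_pos _).le)]
  have := congrArg (fun m => m univ) h.map_eq
  simp only [withDensity_apply _ MeasurableSet.univ, Measure.restrict_univ] at this
  rw [← this]
  exact measure_lt_top _ _

lemma HasShiftLogDensity.pi {ι : Type*} [Fintype ι] {E : ι → Type*} [∀ i, MeasurableSpace (E i)]
    [∀ i, Add (E i)] [∀ i, MeasurableAdd (E i)] {γ : ∀ i, Measure (E i)}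
    [∀ i, IsProbabilityMeasure (γ i)] {s : ∀ i, E i} {φ : ∀ i, E i → ℝ}
    (h : ∀ i, HasShiftLogDensity (γ i) (s i) (φ i)) :
    HasShiftLogDensity (Measure.pi γ) s (fun y => ∑ i, φ i (y i)) := by
  have hm : ∀ i, Measurable (φ i) := fun i => (h i).measurable
  refine ⟨by fun_prop, ?_⟩
  have hadd : ∀ i, Measurable (fun z => s i + z) := fun i => measurable_const_add _
  have hprob : ∀ i, IsProbabilityMeasure ((γ i).map (fun z => s i + z)) := fun i =>
    Measure.isProbabilityMeasure_map (hadd i).aemeasurable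
  have h1 := Measure.pi_map_pi (μ := γ) (f := fun i z => s i + z)
    (fun i => (hadd i).aemeasurable)
  change (Measure.pi γ).map (fun z i => s i + z i) = _
  rw [h1]
  refine Measure.pi_eq fun t ht => ?_
  rw [withDensity_apply _ (MeasurableSet.univ_pi ht), Measure.restrict_pi_pi,
    ← ofReal_integral_eq_lintegral_ofReal ?_ (ae_of_all _ fun _ => (exp_pos _).le)]
  · simp_rw [exp_sum]
    rw [integral_fintype_prod_eq_prod (fun i y => exp (φ i y)),
      ENNReal.ofReal_prod_of_nonneg fun i _ => integral_nonneg fun _ => (exp_pos _).le]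
    refine Finset.prod_congr rfl fun i _ => ?_
    rw [(h i).map_eq, withDensity_apply _ (ht i),
      ← ofReal_integral_eq_lintegral_ofReal (h i).integrable_exp.restrict
        (ae_of_all _ fun _ => (exp_pos _).le)]
  · simp_rw [exp_sum]
    exact Integrable.fintype_prod_dep fun i => (h i).integrable_exp.restrict

lemma HasShiftLogDensity.prod {E F : Type*} [MeasurableSpace E] [MeasurableSpace F] [Add E] [Add F]
    [MeasurableAdd E] [MeasurableAdd F] {γ : Measure E} {γ' : Measure F}
    [IsProbabilityMeasure γ] [IsProbabilityMeasure γ'] {s : E} {s' : F} {φ : E → ℝ} {φ' : F → ℝ}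
    (h : HasShiftLogDensity γ s φ) (h' : HasShiftLogDensity γ' s' φ') :
    HasShiftLogDensity (γ.prod γ') (s, s') (fun y => φ y.1 + φ' y.2) := by
  have hm := h.measurable
  have hm' := h'.measurable
  refine ⟨by fun_prop, ?_⟩
  have := Measure.map_prod_map γ γ' (measurable_const_add s) (measurable_const_add s')
  change (γ.prod γ').map (Prod.map (fun z => s + z) (fun z => s' + z)) = _
  rw [← this, h.map_eq, h'.map_eq, prod_withDensity (by fun_prop) (by fun_prop)]
  congr 1
  ext y
  rw [exp_add, ENNReal.ofReal_mul (exp_pos _).le]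

/-- A Gibbs weight that is a.e. bounded has integrable exponential. -/
lemma integrable_exp_of_bdd {X : Type*} [MeasurableSpace X] {P : Measure X} [IsFiniteMeasure P]
    {Ψ : X → ℝ} (hΨ : Measurable Ψ) (hb : ∃ C, ∀ᵐ x ∂P, |Ψ x| ≤ C) :
    Integrable (fun x => exp (Ψ x)) P := by
  obtain ⟨C, hC⟩ := hb
  refine Integrable.of_bound (by fun_prop) (exp C) ?_
  filter_upwards [hC] with x hx
  rw [norm_of_nonneg (exp_pos _).le]
  exact exp_le_exp.2 (le_of_abs_le hx)

lemma integral_tilted_eq_div {X : Type*} [MeasurableSpace X] (P : Measure X) (Ψ f : X → ℝ) :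
    ∫ x, f x ∂(P.tilted Ψ) = (∫ x, f x * exp (Ψ x) ∂P) / ∫ x, exp (Ψ x) ∂P := by
  rw [integral_tilted, ← integral_div]
  congr 1
  ext x
  simp only [smul_eq_mul]
  ring

lemma measurable_integral_tilted {S X : Type*} [MeasurableSpace S] [MeasurableSpace X]
    {P : Measure X} [SFinite P] {Ψ f : S → X → ℝ} (hΨ : Measurable (Function.uncurry Ψ))
    (hf : Measurable (Function.uncurry f)) :
    Measurable fun s => ∫ x, f s x ∂(P.tilted (Ψ s)) := by
  simp_rw [integral_tilted_eq_div]
  refine Measurable.div ?_ ?_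
  · refine (StronglyMeasurable.integral_prod_right (ν := P)
      (f := fun s x => f s x * exp (Ψ s x)) ?_).measurable
    exact (hf.mul hΨ.exp).stronglyMeasurable
  · refine (StronglyMeasurable.integral_prod_right (ν := P)
      (f := fun s x => exp (Ψ s x)) ?_).measurable
    exact hΨ.exp.stronglyMeasurable

section Channel

variable {X E : Type*} [MeasurableSpace X] [MeasurableSpace E] [Add E] [MeasurableAdd₂ E]
  {P : Measure X} [IsProbabilityMeasure P] {γ : Measure E} [IsProbabilityMeasure γ]
  {s : X → E} {Φ : E → X → ℝ}

/-- The joint law of observation and signal for an additive noise channel. -/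
lemma map_observation_eq_withDensity (hs : Measurable s)
    (hΦ : Measurable (Function.uncurry Φ))
    (hd : ∀ x, HasShiftLogDensity γ (s x) (fun y => Φ y x)) :
    (P.prod γ).map (fun ω : X × E => (s ω.1 + ω.2, ω.1)) =
      (γ.prod P).withDensity fun p => ENNReal.ofReal (exp (Φ p.1 p.2)) := by
  have hΦ' : Measurable fun p : E × X => Φ p.1 p.2 := hΦ
  refine Measure.ext_of_lintegral _ fun f hf => ?_
  have hT : Measurable (fun ω : X × E => (s ω.1 + ω.2, ω.1)) := by fun_prop
  rw [lintegral_map hf hT, lintegral_prod _ (by fun_prop),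
    lintegral_withDensity_eq_lintegral_mul _ (by fun_prop) hf,
    lintegral_prod_symm _ (by fun_prop)]
  refine lintegral_congr fun x => ?_
  have h1 := congrArg (fun m => ∫⁻ y, f (y, x) ∂m) (hd x).map_eq
  have hfx : Measurable fun y => f (y, x) := hf.comp (by fun_prop)
  have hΦx : Measurable fun y => Φ y x := (hd x).measurable
  rw [lintegral_map hfx (by fun_prop),
    lintegral_withDensity_eq_lintegral_mul _ (by fun_prop) hfx] at h1
  exact h1

/-- **Nishimori identity**: a sample of the posterior can replace the signal. -/
lemma integral_posterior_eq (hs : Measurable s) (hΦ : Measurable (Function.uncurry Φ))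
    (hb : ∀ y, ∃ C, ∀ᵐ x ∂P, |Φ y x| ≤ C)
    (hd : ∀ x, HasShiftLogDensity γ (s x) (fun y => Φ y x))
    {G : E → X → ℝ} (hG : Measurable (Function.uncurry G))
    (hi : Integrable (fun ω : X × E => G (s ω.1 + ω.2) ω.1) (P.prod γ))
    (hi' : Integrable (fun ω : X × E => ∫ x, G (s ω.1 + ω.2) x ∂(P.tilted (Φ (s ω.1 + ω.2))))
      (P.prod γ)) :
    ∫ ω : X × E, (∫ x, G (s ω.1 + ω.2) x ∂(P.tilted (Φ (s ω.1 + ω.2)))) ∂(P.prod γ) =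
      ∫ ω : X × E, G (s ω.1 + ω.2) ω.1 ∂(P.prod γ) := by
  have hΦ' : Measurable fun p : E × X => Φ p.1 p.2 := hΦ
  have hT : Measurable (fun ω : X × E => (s ω.1 + ω.2, ω.1)) := by fun_prop
  have key : ∀ g : E × X → ℝ, Measurable g →
      Integrable (fun ω : X × E => g (s ω.1 + ω.2, ω.1)) (P.prod γ) →
      ∫ ω : X × E, g (s ω.1 + ω.2, ω.1) ∂(P.prod γ) =
        ∫ y, ∫ x, exp (Φ y x) * g (y, x) ∂P ∂γ := by
    intro g hg hgi
    have h1 : Integrable g ((P.prod γ).map (fun ω : X × E => (s ω.1 + ω.2, ω.1))) :=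
      (integrable_map_measure hg.aestronglyMeasurable hT.aemeasurable).2 hgi
    rw [← integral_map (f := g) hT.aemeasurable hg.aestronglyMeasurable,
      map_observation_eq_withDensity hs hΦ hd,
      integral_withDensity_eq_integral_toReal_smul hΦ'.exp.ennreal_ofReal
        (ae_of_all _ fun _ => ENNReal.ofReal_lt_top)]
    rw [map_observation_eq_withDensity hs hΦ hd,
      integrable_withDensity_iff_integrable_smul' hΦ'.exp.ennreal_ofReal
        (ae_of_all _ fun _ => ENNReal.ofReal_lt_top)] at h1
    rw [integral_prod _ h1]
    simp [ENNReal.toReal_ofReal (exp_pos _).le]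
  have hmean : Measurable fun y => ∫ x, G y x ∂(P.tilted (Φ y)) :=
    measurable_integral_tilted hΦ hG
  rw [key (fun p => G p.1 p.2) hG hi,
    key (fun p => ∫ x, G p.1 x ∂(P.tilted (Φ p.1))) (hmean.comp measurable_fst) hi']
  congr 1
  ext y
  simp only
  rw [integral_mul_const, integral_tilted_eq_div, mul_div_cancel₀]
  · simp_rw [mul_comm]
  · exact (integral_exp_pos (integrable_exp_of_bdd hΦ.of_uncurry_left (hb y))).ne'

end Channel

lemma exists_ae_abs_gibbsExponent_le {X : Type*} [MeasurableSpace X] {P : Measure X}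
    {Ψ p q : X → ℝ} (hΨ : ∃ C, ∀ᵐ x ∂P, |Ψ x| ≤ C)
    (hp : ∃ C, ∀ᵐ x ∂P, |p x| ≤ C) (hq : ∃ C, ∀ᵐ x ∂P, |q x| ≤ C) (r : ℝ) :
    ∃ C, ∀ᵐ x ∂P, |Ψ x - r * p x + √r * q x| ≤ C := by
  obtain ⟨CΨ, hCΨ⟩ := hΨ
  obtain ⟨Cp, hCp⟩ := hp
  obtain ⟨Cq, hCq⟩ := hq
  refine ⟨CΨ + |r| * Cp + √r * Cq, ?_⟩
  filter_upwards [hCΨ, hCp, hCq] with x h2 h3 h4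
  refine (abs_add_le _ _).trans (add_le_add ((abs_sub _ _).trans (add_le_add h2 ?_)) ?_)
  · rw [abs_mul]; gcongr
  · rw [abs_mul, abs_of_nonneg (sqrt_nonneg r)]; gcongr

section Thermal

variable {X : Type*} [MeasurableSpace X] {P : Measure X} [IsProbabilityMeasure P]
  {f Ψ p q : X → ℝ}

lemma hasDerivAt_integral_mul_exp (hfm : Measurable f) (hΨm : Measurable Ψ) (hpm : Measurable p)
    (hqm : Measurable q) (hf : ∃ C, ∀ᵐ x ∂P, |f x| ≤ C) (hΨ : ∃ C, ∀ᵐ x ∂P, |Ψ x| ≤ C)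
    (hp : ∃ C, ∀ᵐ x ∂P, |p x| ≤ C) (hq : ∃ C, ∀ᵐ x ∂P, |q x| ≤ C) {R : ℝ} (hR : 0 < R) :
    HasDerivAt (fun r => ∫ x, f x * exp (Ψ x - r * p x + √r * q x) ∂P)
      (∫ x, f x * (q x / (2 * √R) - p x) * exp (Ψ x - R * p x + √R * q x) ∂P) R := by
  obtain ⟨Cf, hCf⟩ := hf
  obtain ⟨CΨ, hCΨ⟩ := hΨ
  obtain ⟨Cp, hCp⟩ := hp
  obtain ⟨Cq, hCq⟩ := hq
  have hs : Ioo (R / 2) (2 * R) ∈ nhds R := Ioo_mem_nhds (by linarith) (by linarith)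
  refine (hasDerivAt_integral_of_dominated_loc_of_deriv_le (𝕜 := ℝ) (μ := P) (x₀ := R)
    (F := fun r x => f x * exp (Ψ x - r * p x + √r * q x))
    (F' := fun r x => f x * (q x / (2 * √r) - p x) * exp (Ψ x - r * p x + √r * q x))
    (bound := fun _ => Cf * (Cq / (2 * √(R / 2)) + Cp) * exp (CΨ + 2 * R * Cp + √(2 * R) * Cq))
    hs ?_ ?_ ?_ ?_ (integrable_const _) ?_).2
  · exact Eventually.of_forall fun r => Measurable.aestronglyMeasurable (by fun_prop)
  · refine Integrable.of_bound (Measurable.aestronglyMeasurable (by fun_prop))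
      (Cf * exp (CΨ + R * Cp + √R * Cq)) ?_
    filter_upwards [hCf, hCΨ, hCp, hCq] with x h1 h2 h3 h4
    rw [norm_mul, norm_of_nonneg (exp_pos _).le, norm_eq_abs]
    have := mul_le_mul_of_nonneg_left (neg_le_of_abs_le h3) hR.le
    have := mul_le_mul_of_nonneg_left (le_of_abs_le h4) (sqrt_nonneg R)
    have := le_of_abs_le h2
    gcongr
    · exact (abs_nonneg _).trans h1
    · linarith
  · exact Measurable.aestronglyMeasurable (by fun_prop)
  · filter_upwards [hCf, hCΨ, hCp, hCq] with x h1 h2 h3 h4 r hr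
    have hr0 : 0 < r := by linarith [hr.1]
    have hCp0 := (abs_nonneg _).trans h3
    have hCq0 := (abs_nonneg _).trans h4
    have hCf0 := (abs_nonneg _).trans h1
    rw [norm_mul, norm_mul, norm_of_nonneg (exp_pos _).le, norm_eq_abs, norm_eq_abs]
    have h5 : |q x / (2 * √r) - p x| ≤ Cq / (2 * √(R / 2)) + Cp := by
      refine (abs_sub _ _).trans (add_le_add ?_ h3)
      rw [abs_div, abs_of_pos (a := 2 * √r) (by positivity)]
      have := hr.1.le
      gcongr
    have h6 : Ψ x - r * p x + √r * q x ≤ CΨ + 2 * R * Cp + √(2 * R) * Cq := by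
      have := mul_le_mul_of_nonneg_left (neg_le_of_abs_le h3) hr0.le
      have := mul_le_mul_of_nonneg_left (le_of_abs_le h4) (sqrt_nonneg r)
      have := le_of_abs_le h2
      have : r * Cp ≤ 2 * R * Cp := by gcongr; exact hr.2.le
      have : √r * Cq ≤ √(2 * R) * Cq := by gcongr; exact hr.2.le
      linarith
    gcongr
  · refine ae_of_all _ fun x r hr => ?_
    have hr0 : 0 < r := by linarith [hr.1]
    have h1 : HasDerivAt (fun r => Ψ x - r * p x + √r * q x) (q x / (2 * √r) - p x) r := by
      convert! (((hasDerivAt_id r).mul_const (p x)).const_sub (Ψ x)).add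
        ((hasDerivAt_sqrt hr0.ne').mul_const (q x)) using 1
      ring
    convert! h1.exp.const_mul (f x) using 1
    ring

lemma integrable_tilted_of_bdd (hfm : Measurable f) (hΨm : Measurable Ψ)
    (hf : ∃ C, ∀ᵐ x ∂P, |f x| ≤ C) (hΨ : ∃ C, ∀ᵐ x ∂P, |Ψ x| ≤ C) :
    Integrable f (P.tilted Ψ) := by
  have := isProbabilityMeasure_tilted (integrable_exp_of_bdd hΨm hΨ)
  obtain ⟨C, hC⟩ := hf
  exact Integrable.of_bound hfm.aestronglyMeasurable C
    ((tilted_absolutelyContinuous P Ψ).ae_le hC)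

lemma abs_integral_tilted_le (hΨm : Measurable Ψ) (hΨ : ∃ C, ∀ᵐ x ∂P, |Ψ x| ≤ C) {C : ℝ}
    (hf : ∀ᵐ x ∂P, |f x| ≤ C) : |∫ x, f x ∂(P.tilted Ψ)| ≤ C := by
  have := isProbabilityMeasure_tilted (integrable_exp_of_bdd hΨm hΨ)
  have hf' : ∀ᵐ x ∂(P.tilted Ψ), ‖f x‖ ≤ C := (tilted_absolutelyContinuous P Ψ).ae_le hf
  simpa using norm_integral_le_of_norm_le_const hf'

lemma hasDerivAt_integral_tilted (hfm : Measurable f) (hΨm : Measurable Ψ) (hpm : Measurable p)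
    (hqm : Measurable q) (hf : ∃ C, ∀ᵐ x ∂P, |f x| ≤ C) (hΨ : ∃ C, ∀ᵐ x ∂P, |Ψ x| ≤ C)
    (hp : ∃ C, ∀ᵐ x ∂P, |p x| ≤ C) (hq : ∃ C, ∀ᵐ x ∂P, |q x| ≤ C) {R : ℝ} (hR : 0 < R) :
    HasDerivAt (fun r => ∫ x, f x ∂(P.tilted fun x => Ψ x - r * p x + √r * q x))
      ((∫ x, f x * (q x / (2 * √R) - p x) ∂(P.tilted fun x => Ψ x - R * p x + √R * q x)) -
        (∫ x, f x ∂(P.tilted fun x => Ψ x - R * p x + √R * q x)) *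
        ∫ x, (q x / (2 * √R) - p x) ∂(P.tilted fun x => Ψ x - R * p x + √R * q x)) R := by
  have h1 := hasDerivAt_integral_mul_exp hfm hΨm hpm hqm hf hΨ hp hq hR
  have h2 := hasDerivAt_integral_mul_exp (f := fun _ => 1) measurable_const hΨm hpm hqm
    ⟨1, by simp⟩ hΨ hp hq hR
  simp only [one_mul] at h2
  have hZ : 0 < ∫ x, exp (Ψ x - R * p x + √R * q x) ∂P := integral_exp_pos
    (integrable_exp_of_bdd (by fun_prop) (exists_ae_abs_gibbsExponent_le hΨ hp hq R))
  simp_rw [integral_tilted_eq_div]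
  have hquot : ∀ A B C D : ℝ, D ≠ 0 → A / D - B / D * (C / D) = (A * D - B * C) / D ^ 2 := by
    intro A B C D hD
    field_simp
  convert! h1.div h2 hZ.ne' using 1
  exact hquot _ _ _ _ (ne_of_gt hZ)

/-- The derivative of the mean energy is minus the energy variance, up to the explicit
dependence of the energy on the parameter. -/
lemma hasDerivAt_integral_energy_tilted (hΨm : Measurable Ψ) (hpm : Measurable p)
    (hqm : Measurable q) (hΨ : ∃ C, ∀ᵐ x ∂P, |Ψ x| ≤ C)
    (hp : ∃ C, ∀ᵐ x ∂P, |p x| ≤ C) (hq : ∃ C, ∀ᵐ x ∂P, |q x| ≤ C) {R : ℝ} (hR : 0 < R) :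
    HasDerivAt
      (fun r => ∫ x, (p x - q x / (2 * √r)) ∂(P.tilted fun x => Ψ x - r * p x + √r * q x))
      (-((∫ x, ((p x - q x / (2 * √R)) -
          ∫ x', (p x' - q x' / (2 * √R)) ∂(P.tilted fun x => Ψ x - R * p x + √R * q x)) ^ 2
          ∂(P.tilted fun x => Ψ x - R * p x + √R * q x)) -
        (∫ x, q x ∂(P.tilted fun x => Ψ x - R * p x + √R * q x)) / (4 * R * √R))) R := by
  have hb := exists_ae_abs_gibbsExponent_le hΨ hp hq
  have hip : ∀ r, Integrable p (P.tilted fun x => Ψ x - r * p x + √r * q x) := fun r =>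
    integrable_tilted_of_bdd hpm (by fun_prop) hp (hb r)
  have hiq : ∀ r, Integrable q (P.tilted fun x => Ψ x - r * p x + √r * q x) := fun r =>
    integrable_tilted_of_bdd hqm (by fun_prop) hq (hb r)
  have hprob := isProbabilityMeasure_tilted (integrable_exp_of_bdd (P := P)
    (by fun_prop : Measurable fun x => Ψ x - R * p x + √R * q x) (hb R))
  have h1 := hasDerivAt_integral_tilted hpm hΨm hpm hqm hp hΨ hp hq hR
  have h2 := hasDerivAt_integral_tilted hqm hΨm hpm hqm hq hΨ hp hq hR
  have h3 : HasDerivAt (fun r => (2 * √r)⁻¹) (-(1 / (4 * R * √R))) R := by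
    convert! ((hasDerivAt_sqrt hR.ne').const_mul 2).inv (by positivity) using 1
    have := sq_sqrt hR.le
    field_simp
    rw [this]; ring
  have hmul : ∀ {g h : X → ℝ}, (∃ C, ∀ᵐ x ∂P, |g x| ≤ C) → (∃ C, ∀ᵐ x ∂P, |h x| ≤ C) →
      ∃ C, ∀ᵐ x ∂P, |g x * h x| ≤ C := by
    rintro g h ⟨Cg, hCg⟩ ⟨Ch, hCh⟩
    refine ⟨Cg * Ch, ?_⟩
    filter_upwards [hCg, hCh] with x h1 h2
    rw [abs_mul]
    exact mul_le_mul h1 h2 (abs_nonneg _) ((abs_nonneg _).trans h1)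
  have hipp := integrable_tilted_of_bdd (by fun_prop)
    (by fun_prop : Measurable fun x => Ψ x - R * p x + √R * q x) (hmul hp hp) (hb R)
  have hipq := integrable_tilted_of_bdd (by fun_prop)
    (by fun_prop : Measurable fun x => Ψ x - R * p x + √R * q x) (hmul hp hq) (hb R)
  have hiqq := integrable_tilted_of_bdd (by fun_prop)
    (by fun_prop : Measurable fun x => Ψ x - R * p x + √R * q x) (hmul hq hq) (hb R)
  have hsub : ∀ r, ∫ x, (p x - q x / (2 * √r)) ∂(P.tilted fun x => Ψ x - r * p x + √r * q x) =
      (∫ x, p x ∂(P.tilted fun x => Ψ x - r * p x + √r * q x)) -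
      (∫ x, q x ∂(P.tilted fun x => Ψ x - r * p x + √r * q x)) * (2 * √r)⁻¹ := fun r => by
    rw [integral_sub (hip r) ((hiq r).div_const _), integral_div, div_eq_mul_inv]
  have h4 := h1.sub (h2.mul h3)
  rw [funext hsub]
  convert! h4 using 1
  rw [hsub]
  have := hip R
  have := hiq R
  generalize P.tilted (fun x => Ψ x - R * p x + √R * q x) = Q at *
  generalize hm : (∫ x, p x ∂Q) - (∫ x, q x ∂Q) * (2 * √R)⁻¹ = m
  have e1 : ∫ x, ((p x - q x / (2 * √R)) - m) ^ 2 ∂Q = (∫ x, p x * p x ∂Q)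
      - 2 * (2 * √R)⁻¹ * (∫ x, p x * q x ∂Q) + (2 * √R)⁻¹ ^ 2 * (∫ x, q x * q x ∂Q)
      - 2 * m * (∫ x, p x ∂Q) + 2 * m * (2 * √R)⁻¹ * (∫ x, q x ∂Q) + m ^ 2 := by
    have : ∀ x, ((p x - q x / (2 * √R)) - m) ^ 2 = p x * p x - 2 * (2 * √R)⁻¹ * (p x * q x)
      + (2 * √R)⁻¹ ^ 2 * (q x * q x) - 2 * m * p x + 2 * m * (2 * √R)⁻¹ * q x + m ^ 2 := by
      intro x; rw [div_eq_mul_inv]; ring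
    simp_rw [this]
    rw [integral_add (by fun_prop) (by fun_prop), integral_add (by fun_prop) (by fun_prop),
      integral_sub (by fun_prop) (by fun_prop), integral_add (by fun_prop) (by fun_prop),
      integral_sub (by fun_prop) (by fun_prop)]
    simp only [integral_const_mul, integral_const, probReal_univ, one_smul]
  have e2 : ∫ x, p x * (q x / (2 * √R) - p x) ∂Q =
      (2 * √R)⁻¹ * (∫ x, p x * q x ∂Q) - ∫ x, p x * p x ∂Q := by
    have : ∀ x, p x * (q x / (2 * √R) - p x) = (2 * √R)⁻¹ * (p x * q x) - p x * p x := by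
      intro x; rw [div_eq_mul_inv]; ring
    simp_rw [this]
    rw [integral_sub (by fun_prop) (by fun_prop), integral_const_mul]
  have e3 : ∫ x, q x * (q x / (2 * √R) - p x) ∂Q =
      (2 * √R)⁻¹ * (∫ x, q x * q x ∂Q) - ∫ x, p x * q x ∂Q := by
    have : ∀ x, q x * (q x / (2 * √R) - p x) = (2 * √R)⁻¹ * (q x * q x) - p x * q x := by
      intro x; rw [div_eq_mul_inv]; ring
    simp_rw [this]
    rw [integral_sub (by fun_prop) (by fun_prop), integral_const_mul]
  have e4 : ∫ x, (q x / (2 * √R) - p x) ∂Q = -m := by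
    rw [integral_sub (by fun_prop) (by fun_prop), integral_div, div_eq_mul_inv, ← hm]
    ring
  rw [e1, e2, e3, e4, ← hm]
  ring

end Thermal

section StdGaussian

instance (n : ℕ) : IsProbabilityMeasure (stdGaussian n) := by
  unfold stdGaussian; infer_instance

lemma memLp_eval_stdGaussian {n : ℕ} (j : Fin n) : MemLp (fun z => z j) 2 (stdGaussian n) :=
  (ProbabilityTheory.memLp_id_gaussianReal' 2 (by simp)).comp_measurePreserving
    (measurePreserving_eval (fun _ : Fin n => ProbabilityTheory.gaussianReal 0 1) j)

lemma integral_eval_stdGaussian {n : ℕ} (j : Fin n) : ∫ z, z j ∂(stdGaussian n) = 0 := by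
  unfold stdGaussian
  rw [integral_eval, ProbabilityTheory.integral_id_gaussianReal]

lemma memLp_sum_abs_noise {X E : Type*} [MeasurableSpace X] [MeasurableSpace E] (P : Measure X)
    [IsProbabilityMeasure P] (γ : Measure E) [IsProbabilityMeasure γ] (m : ℕ) :
    MemLp (fun ω : X × E × (Fin m → ℝ) => ∑ j, |ω.2.2 j|) 2
      (P.prod (γ.prod (stdGaussian m))) := by
  refine memLp_finsetSum (f := fun j (ω : X × E × (Fin m → ℝ)) => |ω.2.2 j|) _ fun j _ => ?_
  exact (((memLp_eval_stdGaussian j).comp_snd γ).comp_snd P).abs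

end StdGaussian

instance {E F : Type*} [MeasurableSpace E] [MeasurableSpace F] [Add E] [Add F] [MeasurableAdd₂ E]
    [MeasurableAdd₂ F] : MeasurableAdd₂ (E × F) where
  measurable_add := by
    change Measurable fun p : (E × F) × (E × F) => (p.1.1 + p.2.1, p.1.2 + p.2.2)
    fun_prop

/-- The part of the side-channel energy linear in the signal-to-noise ratio. -/
def linearEnergy {m : ℕ} (α : ℝ) (v V : Fin m → ℝ) : ℝ :=
  α / 2 * ∑ j, v j ^ 2 - α * ∑ j, v j * V j

/-- The interaction of a configuration with the side-channel noise. -/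
def noiseEnergy {m : ℕ} (α : ℝ) (v z : Fin m → ℝ) : ℝ := √α * ∑ j, v j * z j

/-- An additive noise channel with log-likelihood `Φ` and prior `P`, together with a spherical
part `v` of the signal. -/
structure IsSphericalModel {X E : Type*} [MeasurableSpace X] [MeasurableSpace E] [Add E] {m : ℕ}
    (P : Measure X) (γ : Measure E) (s : X → E) (Φ : E → X → ℝ) (v : X → Fin m → ℝ) (c : ℝ) :
    Prop where
  measurable_shift : Measurable s
  measurable_logDensity : Measurable (Function.uncurry Φ)
  bdd : ∀ y, ∃ C, ∀ᵐ x ∂P, |Φ y x| ≤ C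
  shift : ∀ x, HasShiftLogDensity γ (s x) (fun y => Φ y x)
  measurable_signal : Measurable v
  sum_sq : ∀ᵐ x ∂P, ∑ j, v x j ^ 2 = c

/-- The log-weight of the posterior given the observations of the channel and of the Gaussian
side channel at signal-to-noise ratio `R`, in terms of signal and noises. -/
def logWeight {X E : Type*} [Add E] {m : ℕ} (s : X → E) (Φ : E → X → ℝ) (v : X → Fin m → ℝ)
    (α R : ℝ) (ω : X × E × (Fin m → ℝ)) (x : X) : ℝ :=
  Φ (s ω.1 + ω.2.1) x - R * linearEnergy α (v x) (v ω.1) + √R * noiseEnergy α (v x) ω.2.2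

/-- The derivative of the side-channel energy with respect to the signal-to-noise ratio. -/
def sideEnergy {X E : Type*} {m : ℕ} (v : X → Fin m → ℝ) (α R : ℝ) (ω : X × E × (Fin m → ℝ))
    (x : X) : ℝ :=
  linearEnergy α (v x) (v ω.1) - noiseEnergy α (v x) ω.2.2 / (2 * √R)

section Posterior

variable {X E : Type*} [MeasurableSpace X] [Add E] {m : ℕ} (P : Measure X)
  (s : X → E) (Φ : E → X → ℝ) (v : X → Fin m → ℝ) (α R : ℝ) (ω : X × E × (Fin m → ℝ))

/-- The posterior mean of `sideEnergy`. -/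
def energyMean : ℝ :=
  ∫ x, sideEnergy v α R ω x ∂(P.tilted (logWeight s Φ v α R ω))

/-- The posterior variance of `sideEnergy`. -/
def energyVariance : ℝ :=
  ∫ x, (sideEnergy v α R ω x - energyMean P s Φ v α R ω) ^ 2
    ∂(P.tilted (logWeight s Φ v α R ω))

/-- The posterior mean of `noiseEnergy`. -/
def noiseMean : ℝ :=
  ∫ x, noiseEnergy α (v x) ω.2.2 ∂(P.tilted (logWeight s Φ v α R ω))

end Posterior

/-- The log-likelihood of the joint observation of the channel and of the Gaussian side channel
at signal-to-noise ratio `R`. -/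
def logLikelihood {X E : Type*} {m : ℕ} (Φ : E → X → ℝ) (v : X → Fin m → ℝ) (α R : ℝ)
    (y : E × (Fin m → ℝ)) (x : X) : ℝ :=
  Φ y.1 x + ∑ j, (√(α * R) * v x j * y.2 j - (√(α * R) * v x j) ^ 2 / 2)

lemma logLikelihood_observation {X E : Type*} [Add E] {m : ℕ} {s : X → E} {Φ : E → X → ℝ}
    {v : X → Fin m → ℝ} {α R : ℝ} (hα : 0 ≤ α) (hR : 0 ≤ R) (ω : X × E × (Fin m → ℝ)) :
    logLikelihood Φ v α R (s ω.1 + ω.2.1, fun j => √(α * R) * v ω.1 j + ω.2.2 j) =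
      logWeight s Φ v α R ω := by
  ext x
  simp only [logLikelihood, logWeight, linearEnergy, noiseEnergy]
  rw [sub_add, sub_eq_add_neg]
  congr 1
  have h1 : √(α * R) = √R * √α := by rw [mul_comm, sqrt_mul hR]
  have h2 := sq_sqrt hR
  have h3 := sq_sqrt hα
  simp only [Finset.mul_sum, ← Finset.sum_sub_distrib, ← Finset.sum_neg_distrib]
  refine Finset.sum_congr rfl fun j _ => ?_
  rw [h1]
  linear_combination (√α ^ 2 * v x j * v ω.1 j - √α ^ 2 * v x j ^ 2 / 2) * h2 +
    (R * v x j * v ω.1 j - R * v x j ^ 2 / 2) * h3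

section Spherical

variable {X E : Type*} [MeasurableSpace X] [MeasurableSpace E] [Add E]
  {m : ℕ} {P : Measure X} {γ : Measure E}
  {s : X → E} {Φ : E → X → ℝ} {v : X → Fin m → ℝ} {c α R : ℝ}

lemma abs_le_sqrt_of_sum_sq {a : Fin m → ℝ} (h : ∑ j, a j ^ 2 = c) (j : Fin m) : |a j| ≤ √c := by
  refine abs_le_sqrt ?_
  rw [← h]
  exact Finset.single_le_sum (f := fun j => a j ^ 2) (fun i _ => sq_nonneg _) (Finset.mem_univ j)

lemma abs_sum_mul_le_sqrt_mul {a : Fin m → ℝ} (h : ∑ j, a j ^ 2 = c) (z : Fin m → ℝ) :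
    |∑ j, a j * z j| ≤ √c * ∑ j, |z j| := by
  rw [Finset.mul_sum]
  refine (Finset.abs_sum_le_sum_abs _ _).trans (Finset.sum_le_sum fun j _ => ?_)
  rw [abs_mul]
  exact mul_le_mul_of_nonneg_right (abs_le_sqrt_of_sum_sq h j) (abs_nonneg _)

lemma abs_sum_mul_le_of_sum_sq {a b : Fin m → ℝ} (ha : ∑ j, a j ^ 2 = c) (hb : ∑ j, b j ^ 2 = c) :
    |∑ j, a j * b j| ≤ c := by
  have hc : 0 ≤ c := by rw [← ha]; positivity
  have := Finset.sum_mul_sq_le_sq_mul_sq Finset.univ a b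
  rw [ha, hb] at this
  exact abs_le_of_sq_le_sq (by nlinarith) hc

namespace IsSphericalModel

lemma measurable_linearEnergy (h : IsSphericalModel P γ s Φ v c) (V : Fin m → ℝ) :
    Measurable fun x => linearEnergy α (v x) V := by
  have hv := h.measurable_signal
  unfold linearEnergy
  fun_prop

lemma measurable_noiseEnergy (h : IsSphericalModel P γ s Φ v c) (z : Fin m → ℝ) :
    Measurable fun x => noiseEnergy α (v x) z := by
  have hv := h.measurable_signal
  unfold noiseEnergy
  fun_prop

lemma bdd_linearEnergy (h : IsSphericalModel P γ s Φ v c) (V : Fin m → ℝ) :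
    ∃ C, ∀ᵐ x ∂P, |linearEnergy α (v x) V| ≤ C := by
  refine ⟨|α / 2| * |c| + |α| * (√c * ∑ j, |V j|), ?_⟩
  filter_upwards [h.sum_sq] with x hx
  unfold linearEnergy
  refine (abs_sub _ _).trans ?_
  rw [abs_mul, abs_mul, hx]
  have := abs_sum_mul_le_sqrt_mul hx V
  gcongr

lemma abs_noiseEnergy_le (h : IsSphericalModel P γ s Φ v c) (z : Fin m → ℝ) :
    ∀ᵐ x ∂P, |noiseEnergy α (v x) z| ≤ √α * (√c * ∑ j, |z j|) := by
  filter_upwards [h.sum_sq] with x hx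
  unfold noiseEnergy
  rw [abs_mul, abs_of_nonneg (sqrt_nonneg _)]
  have := abs_sum_mul_le_sqrt_mul hx z
  gcongr

lemma ae_sum_sq (h : IsSphericalModel P γ s Φ v c) :
    ∀ᵐ ω ∂(P.prod (γ.prod (stdGaussian m))), ∑ j, v ω.1 j ^ 2 = c :=
  Measure.quasiMeasurePreserving_fst.ae h.sum_sq

lemma measurable_logLikelihood (h : IsSphericalModel P γ s Φ v c) (α R : ℝ) :
    Measurable (Function.uncurry (logLikelihood Φ v α R)) := by
  have hv := h.measurable_signal
  have hΦ := h.measurable_logDensity.comp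
    (by fun_prop : Measurable fun p : (E × (Fin m → ℝ)) × X => (p.1.1, p.2))
  simp only [Function.comp_def, Function.uncurry] at hΦ
  simp only [Function.uncurry_def, logLikelihood]
  exact hΦ.add (by fun_prop)

lemma bdd_logWeight (h : IsSphericalModel P γ s Φ v c) (ω : X × E × (Fin m → ℝ)) :
    ∃ C, ∀ᵐ x ∂P, |logWeight s Φ v α R ω x| ≤ C :=
  exists_ae_abs_gibbsExponent_le (h.bdd _) (h.bdd_linearEnergy _) ⟨_, h.abs_noiseEnergy_le _⟩ R

variable [MeasurableAdd₂ E]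

lemma measurable_logWeight (h : IsSphericalModel P γ s Φ v c) (α : ℝ) :
    Measurable fun p : (ℝ × X × E × (Fin m → ℝ)) × X => logWeight s Φ v α p.1.1 p.1.2 p.2 := by
  have hs := h.measurable_shift
  have hv := h.measurable_signal
  have hΦ := h.measurable_logDensity.comp
    (by fun_prop : Measurable fun p : (ℝ × X × E × (Fin m → ℝ)) × X =>
      (s p.1.2.1 + p.1.2.2.1, p.2))
  simp only [Function.comp_def, Function.uncurry] at hΦ
  unfold logWeight linearEnergy noiseEnergy
  exact (hΦ.sub (by fun_prop)).add (by fun_prop)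

lemma measurable_logWeight_right (h : IsSphericalModel P γ s Φ v c) (α R : ℝ)
    (ω : X × E × (Fin m → ℝ)) : Measurable (logWeight s Φ v α R ω) :=
  (h.measurable_logWeight α).comp (by fun_prop : Measurable fun x => ((R, ω), x))

variable [IsProbabilityMeasure P]

lemma integrable_tilted (h : IsSphericalModel P γ s Φ v c) (ω : X × E × (Fin m → ℝ)) {f : X → ℝ}
    (hfm : Measurable f) (hf : ∃ C, ∀ᵐ x ∂P, |f x| ≤ C) :
    Integrable f (P.tilted (logWeight s Φ v α R ω)) :=
  integrable_tilted_of_bdd hfm (h.measurable_logWeight_right α R ω) hf (h.bdd_logWeight ω)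

lemma abs_integral_tilted_le (h : IsSphericalModel P γ s Φ v c) (ω : X × E × (Fin m → ℝ))
    {f : X → ℝ} {C : ℝ} (hf : ∀ᵐ x ∂P, |f x| ≤ C) :
    |∫ x, f x ∂(P.tilted (logWeight s Φ v α R ω))| ≤ C :=
  _root_.abs_integral_tilted_le (h.measurable_logWeight_right α R ω) (h.bdd_logWeight ω) hf

lemma isProbabilityMeasure_tilted (h : IsSphericalModel P γ s Φ v c) (α R : ℝ)
    (ω : X × E × (Fin m → ℝ)) : IsProbabilityMeasure (P.tilted (logWeight s Φ v α R ω)) :=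
  MeasureTheory.isProbabilityMeasure_tilted
    (integrable_exp_of_bdd (h.measurable_logWeight_right α R ω) (h.bdd_logWeight ω))

lemma measurable_posterior_integral (h : IsSphericalModel P γ s Φ v c) (α R : ℝ)
    {f : X × E × (Fin m → ℝ) → X → ℝ} (hf : Measurable (Function.uncurry f)) :
    Measurable fun ω => ∫ x, f ω x ∂(P.tilted (logWeight s Φ v α R ω)) := by
  refine measurable_integral_tilted (Ψ := fun ω => logWeight s Φ v α R ω) ?_ hf
  exact (h.measurable_logWeight α).comp
    (by fun_prop : Measurable fun p : (X × E × (Fin m → ℝ)) × X => ((R, p.1), p.2))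

variable [IsProbabilityMeasure γ]

/-- The Nishimori identity for the channel together with its side channel. -/
lemma integral_posterior_eq (h : IsSphericalModel P γ s Φ v c) (hα : 0 ≤ α) (hR : 0 ≤ R)
    {G : E × (Fin m → ℝ) → X → ℝ} (hG : Measurable (Function.uncurry G))
    (hi : Integrable (fun ω : X × E × (Fin m → ℝ) =>
      G (s ω.1 + ω.2.1, fun j => √(α * R) * v ω.1 j + ω.2.2 j) ω.1)
      (P.prod (γ.prod (stdGaussian m))))
    (hi' : Integrable (fun ω : X × E × (Fin m → ℝ) =>
      ∫ x, G (s ω.1 + ω.2.1, fun j => √(α * R) * v ω.1 j + ω.2.2 j) x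
        ∂(P.tilted (logWeight s Φ v α R ω)))
      (P.prod (γ.prod (stdGaussian m)))) :
    ∫ ω : X × E × (Fin m → ℝ),
      (∫ x, G (s ω.1 + ω.2.1, fun j => √(α * R) * v ω.1 j + ω.2.2 j) x
        ∂(P.tilted (logWeight s Φ v α R ω))) ∂(P.prod (γ.prod (stdGaussian m))) =
    ∫ ω : X × E × (Fin m → ℝ), G (s ω.1 + ω.2.1, fun j => √(α * R) * v ω.1 j + ω.2.2 j) ω.1
      ∂(P.prod (γ.prod (stdGaussian m))) := by
  have hs := h.measurable_shift
  have hv := h.measurable_signal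
  set S : X → E × (Fin m → ℝ) := fun x => (s x, fun j => √(α * R) * v x j) with hS
  have hw : ∀ ω : X × E × (Fin m → ℝ), logLikelihood Φ v α R (S ω.1 + ω.2) =
      logWeight s Φ v α R ω := fun ω => logLikelihood_observation hα hR ω
  have key := _root_.integral_posterior_eq (P := P) (γ := γ.prod (stdGaussian m)) (s := S)
    (Φ := logLikelihood Φ v α R) (G := G) (by fun_prop) (h.measurable_logLikelihood α R)
    ?_ ?_ hG ?_ ?_
  · simp only [hw] at key
    exact key
  · intro y
    obtain ⟨C, hC⟩ := h.bdd y.1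
    refine ⟨C + (|√(α * R)| * (√c * ∑ j, |y.2 j|) + (√(α * R)) ^ 2 / 2 * |c|), ?_⟩
    filter_upwards [hC, h.sum_sq] with x h1 h2
    have h3 : ∑ j, (√(α * R) * v x j * y.2 j - (√(α * R) * v x j) ^ 2 / 2) =
        √(α * R) * ∑ j, v x j * y.2 j - (√(α * R)) ^ 2 / 2 * c := by
      rw [← h2, Finset.mul_sum, Finset.mul_sum, ← Finset.sum_sub_distrib]
      exact Finset.sum_congr rfl fun j _ => by ring
    simp only [logLikelihood]
    rw [h3]
    refine (abs_add_le _ _).trans (add_le_add h1 ((abs_sub _ _).trans ?_))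
    rw [abs_mul, abs_mul, abs_of_nonneg (a := (√(α * R)) ^ 2 / 2) (by positivity)]
    have := abs_sum_mul_le_sqrt_mul h2 y.2
    gcongr
  · intro x
    exact (h.shift x).prod
      (HasShiftLogDensity.pi fun j => hasShiftLogDensity_gaussianReal (√(α * R) * v x j))
  · exact hi
  · simp only [hw]
    exact hi'

lemma integrable_posterior_overlap (h : IsSphericalModel P γ s Φ v c) (α R : ℝ) :
    Integrable (fun ω : X × E × (Fin m → ℝ) =>
      ∫ x, ∑ j, v x j * v ω.1 j ∂(P.tilted (logWeight s Φ v α R ω)))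
      (P.prod (γ.prod (stdGaussian m))) := by
  have hv := h.measurable_signal
  refine Integrable.of_bound (h.measurable_posterior_integral α R
    (f := fun ω x => ∑ j, v x j * v ω.1 j)
    (by simp only [Function.uncurry_def]; fun_prop)).aestronglyMeasurable c ?_
  filter_upwards [h.ae_sum_sq] with ω hω
  refine h.abs_integral_tilted_le ω ?_
  filter_upwards [h.sum_sq] with x hx
  exact abs_sum_mul_le_of_sum_sq hx hω

lemma integrable_posterior_noise (h : IsSphericalModel P γ s Φ v c) (α R : ℝ) :
    Integrable (fun ω : X × E × (Fin m → ℝ) =>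
      ∫ x, ∑ j, v x j * ω.2.2 j ∂(P.tilted (logWeight s Φ v α R ω)))
      (P.prod (γ.prod (stdGaussian m))) := by
  have hv := h.measurable_signal
  refine Integrable.mono' (((memLp_sum_abs_noise P γ m).integrable one_le_two).const_mul √c)
    (h.measurable_posterior_integral α R (f := fun ω x => ∑ j, v x j * ω.2.2 j)
      (by simp only [Function.uncurry_def]; fun_prop)).aestronglyMeasurable ?_
  refine ae_of_all _ fun ω => h.abs_integral_tilted_le ω ?_
  filter_upwards [h.sum_sq] with x hx
  exact abs_sum_mul_le_sqrt_mul hx _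

lemma posterior_overlap_le (h : IsSphericalModel P γ s Φ v c) (α R : ℝ) :
    ∫ ω : X × E × (Fin m → ℝ), (∫ x, ∑ j, v x j * v ω.1 j ∂(P.tilted (logWeight s Φ v α R ω)))
      ∂(P.prod (γ.prod (stdGaussian m))) ≤ c := by
  have := integral_mono_ae (h.integrable_posterior_overlap α R)
    (integrable_const (μ := P.prod (γ.prod (stdGaussian m))) c) ?_
  · simpa using this
  · filter_upwards [h.ae_sum_sq] with ω hω
    refine (le_abs_self _).trans (h.abs_integral_tilted_le ω ?_)
    filter_upwards [h.sum_sq] with x hx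
    exact abs_sum_mul_le_of_sum_sq hx hω

lemma posterior_overlap_nonneg (h : IsSphericalModel P γ s Φ v c) (hα : 0 ≤ α) (hR : 0 ≤ R) :
    0 ≤ ∫ ω : X × E × (Fin m → ℝ),
      (∫ x, ∑ j, v x j * v ω.1 j ∂(P.tilted (logWeight s Φ v α R ω)))
      ∂(P.prod (γ.prod (stdGaussian m))) := by
  have hv := h.measurable_signal
  set M : E × (Fin m → ℝ) → Fin m → ℝ :=
    fun y j => ∫ x, v x j ∂(P.tilted (logLikelihood Φ v α R y)) with hM
  have hMm : ∀ j, Measurable fun y => M y j := fun j =>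
    measurable_integral_tilted (h.measurable_logLikelihood α R) (f := fun _ x => v x j)
      (by simp only [Function.uncurry_def]; fun_prop)
  have hMω : ∀ (ω : X × E × (Fin m → ℝ)) j,
      M (s ω.1 + ω.2.1, fun j => √(α * R) * v ω.1 j + ω.2.2 j) j =
        ∫ x, v x j ∂(P.tilted (logWeight s Φ v α R ω)) := fun ω j => by
    simp only [hM, logLikelihood_observation hα hR]
  have hvj : ∀ j, ∀ᵐ x ∂P, |v x j| ≤ √c := fun j => by
    filter_upwards [h.sum_sq] with x hx
    exact abs_le_sqrt_of_sum_sq hx j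
  have hvi : ∀ j (ω : X × E × (Fin m → ℝ)),
      Integrable (fun x => v x j) (P.tilted (logWeight s Φ v α R ω)) := fun j ω =>
    h.integrable_tilted ω (by fun_prop) ⟨√c, hvj j⟩
  have hlin : ∀ (ω : X × E × (Fin m → ℝ)) (a : Fin m → ℝ),
      ∫ x, ∑ j, a j * v x j ∂(P.tilted (logWeight s Φ v α R ω)) =
        ∑ j, a j * ∫ x, v x j ∂(P.tilted (logWeight s Φ v α R ω)) := fun ω a => by
    rw [integral_finsetSum _ fun j _ => (hvi j ω).const_mul _]
    simp only [integral_const_mul]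
  have hself : ∀ ω : X × E × (Fin m → ℝ),
      ∫ x, ∑ j, v x j * v ω.1 j ∂(P.tilted (logWeight s Φ v α R ω)) =
        ∑ j, (∫ x, v x j ∂(P.tilted (logWeight s Φ v α R ω))) * v ω.1 j := fun ω => by
    simp_rw [mul_comm _ (v ω.1 _)]
    exact hlin ω _
  have key := h.integral_posterior_eq hα hR (G := fun y x => ∑ j, M y j * v x j)
    (by simp only [Function.uncurry_def]; fun_prop) ?_ ?_
  · simp only [hMω, hlin] at key
    simp only [hself]
    rw [← key]
    exact integral_nonneg fun ω => Finset.sum_nonneg fun j _ => mul_self_nonneg _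
  · simp only [hMω, ← hself]
    exact h.integrable_posterior_overlap α R
  · simp only [hMω, hlin]
    refine integrable_finsetSum _ fun j _ => ?_
    have hmj := h.measurable_posterior_integral α R (f := fun _ x => v x j)
      (by simp only [Function.uncurry_def]; fun_prop)
    refine Integrable.of_bound (hmj.mul hmj).aestronglyMeasurable (√c * √c)
      (ae_of_all _ fun ω => ?_)
    rw [norm_mul]
    have : ‖∫ x, v x j ∂(P.tilted (logWeight s Φ v α R ω))‖ ≤ √c :=
      h.abs_integral_tilted_le ω (hvj j)
    gcongr

lemma posterior_noise_eq (h : IsSphericalModel P γ s Φ v c) (hα : 0 ≤ α) (hR : 0 ≤ R) :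
    ∫ ω : X × E × (Fin m → ℝ), (∫ x, ∑ j, v x j * ω.2.2 j ∂(P.tilted (logWeight s Φ v α R ω)))
      ∂(P.prod (γ.prod (stdGaussian m))) =
    √(α * R) * (c - ∫ ω : X × E × (Fin m → ℝ),
      (∫ x, ∑ j, v x j * v ω.1 j ∂(P.tilted (logWeight s Φ v α R ω)))
      ∂(P.prod (γ.prod (stdGaussian m)))) := by
  have hv := h.measurable_signal
  have hsplit : ∀ (ω : X × E × (Fin m → ℝ)) x,
      ∑ j, v x j * (√(α * R) * v ω.1 j + ω.2.2 j) =
        √(α * R) * ∑ j, v x j * v ω.1 j + ∑ j, v x j * ω.2.2 j := fun ω x => by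
    rw [Finset.mul_sum, ← Finset.sum_add_distrib]
    exact Finset.sum_congr rfl fun j _ => by ring
  have hmean : ∀ ω : X × E × (Fin m → ℝ),
      ∫ x, ∑ j, v x j * (√(α * R) * v ω.1 j + ω.2.2 j) ∂(P.tilted (logWeight s Φ v α R ω)) =
        √(α * R) * (∫ x, ∑ j, v x j * v ω.1 j ∂(P.tilted (logWeight s Φ v α R ω))) +
          ∫ x, ∑ j, v x j * ω.2.2 j ∂(P.tilted (logWeight s Φ v α R ω)) := fun ω => by
    simp_rw [hsplit]
    rw [integral_add, integral_const_mul]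
    · refine Integrable.const_mul (h.integrable_tilted ω (by fun_prop) ⟨√c * ∑ j, |v ω.1 j|, ?_⟩) _
      filter_upwards [h.sum_sq] with x hx
      exact abs_sum_mul_le_sqrt_mul hx _
    · refine h.integrable_tilted ω (by fun_prop) ⟨√c * ∑ j, |ω.2.2 j|, ?_⟩
      filter_upwards [h.sum_sq] with x hx
      exact abs_sum_mul_le_sqrt_mul hx _
  have hV : ∀ᵐ ω ∂(P.prod (γ.prod (stdGaussian m))),
      √(α * R) * c + ∑ j, v ω.1 j * ω.2.2 j =
        ∑ j, v ω.1 j * (√(α * R) * v ω.1 j + ω.2.2 j) := by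
    filter_upwards [h.ae_sum_sq] with ω hω
    rw [hsplit, ← hω]
    simp only [pow_two]
  have hvi : ∀ j, Integrable (fun x => v x j) P := fun j => by
    refine Integrable.of_bound (Measurable.aestronglyMeasurable (by fun_prop)) √c ?_
    filter_upwards [h.sum_sq] with x hx
    exact abs_le_sqrt_of_sum_sq hx j
  have hzi : ∀ j, Integrable (fun y : E × (Fin m → ℝ) => y.2 j) (γ.prod (stdGaussian m)) := fun j =>
    ((memLp_eval_stdGaussian j).comp_snd γ).integrable one_le_two
  have hVz : ∀ j, Integrable (fun ω : X × E × (Fin m → ℝ) => v ω.1 j * ω.2.2 j)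
      (P.prod (γ.prod (stdGaussian m))) := fun j => (hvi j).mul_prod (hzi j)
  have hVzi : Integrable (fun ω : X × E × (Fin m → ℝ) => √(α * R) * c + ∑ j, v ω.1 j * ω.2.2 j)
      (P.prod (γ.prod (stdGaussian m))) :=
    (integrable_const _).add (integrable_finsetSum _ fun j _ => hVz j)
  have hVz0 : ∀ j, ∫ ω : X × E × (Fin m → ℝ), v ω.1 j * ω.2.2 j
      ∂(P.prod (γ.prod (stdGaussian m))) = 0 := fun j => by
    rw [integral_prod_mul (fun x => v x j) (fun y : E × (Fin m → ℝ) => y.2 j), integral_fun_snd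
      (fun z : Fin m → ℝ => z j), integral_eval_stdGaussian]
    simp
  have key := h.integral_posterior_eq hα hR (G := fun y x => ∑ j, v x j * y.2 j)
    (by simp only [Function.uncurry_def]; fun_prop) (hVzi.congr hV) ?_
  · simp only [hmean] at key
    rw [integral_add ((h.integrable_posterior_overlap α R).const_mul _)
      (h.integrable_posterior_noise α R), integral_const_mul, ← integral_congr_ae hV,
      integral_add (integrable_const _) (integrable_finsetSum _ fun j _ => hVz j),
      integral_finsetSum _ fun j _ => hVz j] at key
    simp only [hVz0, integral_const, probReal_univ, Finset.sum_const_zero, one_smul] at key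
    linarith
  · simp only [hmean]
    exact ((h.integrable_posterior_overlap α R).const_mul _).add (h.integrable_posterior_noise α R)

end IsSphericalModel

end Spherical

lemma energyVariance_nonneg {X E : Type*} [MeasurableSpace X] [Add E] {m : ℕ} {P : Measure X}
    {s : X → E} {Φ : E → X → ℝ} {v : X → Fin m → ℝ} {α R : ℝ} (ω : X × E × (Fin m → ℝ)) :
    0 ≤ energyVariance P s Φ v α R ω :=
  integral_nonneg fun _ => sq_nonneg _

section EnergyVariance

variable {X E : Type*} [MeasurableSpace X] [MeasurableSpace E] [Add E]
  {m : ℕ} {P : Measure X} {γ : Measure E}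
  {s : X → E} {Φ : E → X → ℝ} {v : X → Fin m → ℝ} {c α R : ℝ}

namespace IsSphericalModel

lemma ae_abs_sideEnergy_le (h : IsSphericalModel P γ s Φ v c) (hα : 0 ≤ α) {a : ℝ} (ha : 0 < a) :
    ∀ᵐ ω ∂(P.prod (γ.prod (stdGaussian m))), ∀ R, a ≤ R → ∀ᵐ x ∂P,
      |sideEnergy v α R ω x| ≤ α / 2 * c + α * c + √α * √c / (2 * √a) * ∑ j, |ω.2.2 j| := by
  filter_upwards [h.ae_sum_sq] with ω hω R hR
  filter_upwards [h.sum_sq, h.abs_noiseEnergy_le (α := α) ω.2.2] with x hx hn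
  have hov := abs_sum_mul_le_of_sum_sq hx hω
  have hc : 0 ≤ c := (abs_nonneg _).trans hov
  unfold sideEnergy
  refine (abs_sub _ _).trans (add_le_add ?_ ?_)
  · unfold linearEnergy
    refine (abs_sub _ _).trans ?_
    rw [hx, abs_of_nonneg (by positivity), abs_mul, abs_of_nonneg hα]
    gcongr
  · rw [abs_div, abs_of_nonneg (a := 2 * √R) (by positivity), div_mul_eq_mul_div, mul_assoc]
    gcongr

variable [IsProbabilityMeasure P]

lemma hasDerivAt_energyMean (h : IsSphericalModel P γ s Φ v c) (ω : X × E × (Fin m → ℝ))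
    (hR : 0 < R) :
    HasDerivAt (fun r => energyMean P s Φ v α r ω)
      (-(energyVariance P s Φ v α R ω - noiseMean P s Φ v α R ω / (4 * R * √R))) R := by
  refine hasDerivAt_integral_energy_tilted (Ψ := Φ (s ω.1 + ω.2.1)) ?_
    (h.measurable_linearEnergy (v ω.1)) (h.measurable_noiseEnergy ω.2.2) (h.bdd _)
    (h.bdd_linearEnergy _) ⟨_, h.abs_noiseEnergy_le _⟩ hR
  exact h.measurable_logDensity.comp measurable_prodMk_left

variable [MeasurableAdd₂ E]

lemma abs_noiseMean_le (h : IsSphericalModel P γ s Φ v c) (ω : X × E × (Fin m → ℝ)) :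
    |noiseMean P s Φ v α R ω| ≤ √α * (√c * ∑ j, |ω.2.2 j|) :=
  h.abs_integral_tilted_le ω (h.abs_noiseEnergy_le _)

lemma energyMean_eq (h : IsSphericalModel P γ s Φ v c) (α R : ℝ) (ω : X × E × (Fin m → ℝ)) :
    energyMean P s Φ v α R ω = α / 2 * c -
      α * (∫ x, ∑ j, v x j * v ω.1 j ∂(P.tilted (logWeight s Φ v α R ω))) -
      noiseMean P s Φ v α R ω / (2 * √R) := by
  have := h.isProbabilityMeasure_tilted α R ω
  have hv := h.measurable_signal
  have hae : (fun x => sideEnergy v α R ω x) =ᵐ[P.tilted (logWeight s Φ v α R ω)] fun x =>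
      α / 2 * c - α * (∑ j, v x j * v ω.1 j) - noiseEnergy α (v x) ω.2.2 / (2 * √R) := by
    filter_upwards [(tilted_absolutelyContinuous P _).ae_le h.sum_sq] with x hx
    simp only [sideEnergy, linearEnergy, hx]
  have hov : Integrable (fun x => ∑ j, v x j * v ω.1 j) (P.tilted (logWeight s Φ v α R ω)) := by
    refine h.integrable_tilted ω (by fun_prop) ⟨√c * ∑ j, |v ω.1 j|, ?_⟩
    filter_upwards [h.sum_sq] with x hx
    exact abs_sum_mul_le_sqrt_mul hx _
  have hno : Integrable (fun x => noiseEnergy α (v x) ω.2.2)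
      (P.tilted (logWeight s Φ v α R ω)) :=
    h.integrable_tilted ω (h.measurable_noiseEnergy _) ⟨_, h.abs_noiseEnergy_le _⟩
  unfold energyMean noiseMean
  rw [integral_congr_ae hae, integral_sub (by fun_prop) (by fun_prop),
    integral_sub (by fun_prop) (by fun_prop), integral_const, integral_const_mul, integral_div]
  simp

lemma measurable_energyMean (h : IsSphericalModel P γ s Φ v c) (α : ℝ) :
    Measurable fun q : ℝ × X × E × (Fin m → ℝ) => energyMean P s Φ v α q.1 q.2 := by
  have hv := h.measurable_signal
  refine measurable_integral_tilted
    (Ψ := fun q : ℝ × X × E × (Fin m → ℝ) => logWeight s Φ v α q.1 q.2)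
    (h.measurable_logWeight α) ?_
  simp only [Function.uncurry_def, sideEnergy, linearEnergy, noiseEnergy]
  fun_prop

lemma measurable_energyVariance (h : IsSphericalModel P γ s Φ v c) (α : ℝ) :
    Measurable fun q : ℝ × X × E × (Fin m → ℝ) => energyVariance P s Φ v α q.1 q.2 := by
  have hv := h.measurable_signal
  have hm := (h.measurable_energyMean α).comp
    (measurable_fst : Measurable fun q : (ℝ × X × E × (Fin m → ℝ)) × X => q.1)
  refine measurable_integral_tilted
    (Ψ := fun q : ℝ × X × E × (Fin m → ℝ) => logWeight s Φ v α q.1 q.2)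
    (f := fun q x => (sideEnergy v α q.1 q.2 x - energyMean P s Φ v α q.1 q.2) ^ 2)
    (h.measurable_logWeight α) (Measurable.pow_const (Measurable.sub ?_ hm) 2)
  simp only [sideEnergy, linearEnergy, noiseEnergy]
  fun_prop

lemma measurable_noiseMean (h : IsSphericalModel P γ s Φ v c) (α : ℝ) :
    Measurable fun q : ℝ × X × E × (Fin m → ℝ) => noiseMean P s Φ v α q.1 q.2 := by
  have hv := h.measurable_signal
  refine measurable_integral_tilted
    (Ψ := fun q : ℝ × X × E × (Fin m → ℝ) => logWeight s Φ v α q.1 q.2)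
    (h.measurable_logWeight α) ?_
  simp only [Function.uncurry_def, noiseEnergy]
  fun_prop

variable [IsProbabilityMeasure γ]

/-- An integrable function of the noise dominating the energy variance. -/
lemma exists_integrable_energyVariance_le (h : IsSphericalModel P γ s Φ v c) (hα : 0 ≤ α)
    {a : ℝ} (ha : 0 < a) :
    ∃ g : X × E × (Fin m → ℝ) → ℝ, Integrable g (P.prod (γ.prod (stdGaussian m))) ∧
      ∀ᵐ ω ∂(P.prod (γ.prod (stdGaussian m))), ∀ R, a ≤ R →
        energyVariance P s Φ v α R ω ≤ g ω := by
  have hB2 := (memLp_const (α / 2 * c + α * c)).add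
    ((memLp_sum_abs_noise P γ m).const_mul (√α * √c / (2 * √a)))
  have hB := h.ae_abs_sideEnergy_le (γ := γ) hα ha
  generalize α / 2 * c + α * c = C₁ at hB hB2
  generalize √α * √c / (2 * √a) = C₂ at hB hB2
  set B : X × E × (Fin m → ℝ) → ℝ := fun ω => C₁ + C₂ * ∑ j, |ω.2.2 j|
  replace hB2 : MemLp B 2 (P.prod (γ.prod (stdGaussian m))) := hB2
  refine ⟨fun ω => 4 * B ω ^ 2, hB2.integrable_sq.const_mul 4, ?_⟩
  filter_upwards [hB] with ω hω R hR
  have hm : |energyMean P s Φ v α R ω| ≤ B ω := h.abs_integral_tilted_le ω (hω R hR)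
  refine (le_abs_self _).trans (h.abs_integral_tilted_le ω ?_)
  filter_upwards [hω R hR] with x hx
  rw [abs_of_nonneg (sq_nonneg _), show 4 * B ω ^ 2 = (B ω + B ω) ^ 2 by ring]
  exact sq_le_sq' (by linarith [abs_le.1 hx, abs_le.1 hm]) (by linarith [abs_le.1 hx, abs_le.1 hm])

lemma integrable_energyVariance (h : IsSphericalModel P γ s Φ v c) (hα : 0 ≤ α) (hR : 0 < R) :
    Integrable (energyVariance P s Φ v α R) (P.prod (γ.prod (stdGaussian m))) := by
  obtain ⟨g, hg, hle⟩ := h.exists_integrable_energyVariance_le hα hR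
  refine hg.mono' ((h.measurable_energyVariance α).comp
    (measurable_prodMk_left (x := R))).aestronglyMeasurable ?_
  filter_upwards [hle] with ω hω
  rw [norm_of_nonneg (energyVariance_nonneg ω)]
  exact hω R le_rfl

lemma integrable_noiseMean (h : IsSphericalModel P γ s Φ v c) (α R : ℝ) :
    Integrable (noiseMean P s Φ v α R) (P.prod (γ.prod (stdGaussian m))) := by
  have := (h.integrable_posterior_noise α R).const_mul √α
  simp only [← integral_const_mul] at this
  exact this

lemma integral_noiseMean (h : IsSphericalModel P γ s Φ v c) (hα : 0 ≤ α) (hR : 0 ≤ R) :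
    ∫ ω, noiseMean P s Φ v α R ω ∂(P.prod (γ.prod (stdGaussian m))) =
      α * √R * (c - ∫ ω : X × E × (Fin m → ℝ),
      (∫ x, ∑ j, v x j * v ω.1 j ∂(P.tilted (logWeight s Φ v α R ω)))
      ∂(P.prod (γ.prod (stdGaussian m)))) := by
  simp only [noiseMean, noiseEnergy, integral_const_mul]
  rw [h.posterior_noise_eq hα hR, sqrt_mul hα, ← mul_assoc, ← mul_assoc, mul_self_sqrt hα]

lemma integrable_energyMean (h : IsSphericalModel P γ s Φ v c) (α R : ℝ) :
    Integrable (energyMean P s Φ v α R) (P.prod (γ.prod (stdGaussian m))) := by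
  rw [funext (h.energyMean_eq α R)]
  exact ((integrable_const _).sub ((h.integrable_posterior_overlap α R).const_mul _)).sub
    ((h.integrable_noiseMean α R).div_const _)

lemma integral_energyMean (h : IsSphericalModel P γ s Φ v c) (hα : 0 ≤ α) (hR : 0 < R) :
    ∫ ω, energyMean P s Φ v α R ω ∂(P.prod (γ.prod (stdGaussian m))) =
      -(α / 2) * ∫ ω : X × E × (Fin m → ℝ),
      (∫ x, ∑ j, v x j * v ω.1 j ∂(P.tilted (logWeight s Φ v α R ω)))
      ∂(P.prod (γ.prod (stdGaussian m))) := by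
  have hov := h.integrable_posterior_overlap (γ := γ) α R
  have hno := h.integrable_noiseMean (γ := γ) α R
  simp only [h.energyMean_eq α R]
  rw [integral_sub (by fun_prop) (by fun_prop), integral_sub (by fun_prop) (by fun_prop),
    integral_const, integral_const_mul, integral_div, h.integral_noiseMean hα hR.le]
  have : √R ≠ 0 := (sqrt_pos.2 hR).ne'
  simp only [probReal_univ, one_smul]
  field_simp
  ring

/-- The energy variance integrates over the signal-to-noise ratio to an overlap difference plus a
logarithmic term. -/
lemma intervalIntegral_energyVariance_le (h : IsSphericalModel P γ s Φ v c) (hα : 0 ≤ α)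
    {a b : ℝ} (ha : 0 < a) (hab : a ≤ b) :
    ∫ R in a..b, ∫ ω, energyVariance P s Φ v α R ω ∂(P.prod (γ.prod (stdGaussian m))) ≤
      α * c / 2 + α * c / 4 * log (b / a) := by
  set μ := P.prod (γ.prod (stdGaussian m)) with hμ
  obtain ⟨g, hg, hgle⟩ := h.exists_integrable_energyVariance_le (γ := γ) hα ha
  have hpos : ∀ {R}, R ∈ uIcc a b → 0 < R := fun hR => by
    rw [uIcc_of_le hab] at hR; exact ha.trans_le hR.1
  set ν := (volume : Measure ℝ).restrict (uIoc a b) with hν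
  have : IsFiniteMeasure ν := by rw [hν, uIoc_of_le hab]; infer_instance
  have hνR : ∀ᵐ R ∂ν, a ≤ R := by
    refine (ae_restrict_mem measurableSet_uIoc).mono fun R hR => ?_
    rw [uIoc_of_le hab] at hR
    exact hR.1.le
  have hfst : ∀ᵐ q ∂(ν.prod μ), a ≤ q.1 := Measure.quasiMeasurePreserving_fst.ae hνR
  have hsnd : ∀ᵐ q ∂(ν.prod μ), ∀ R, a ≤ R → energyVariance P s Φ v α R q.2 ≤ g q.2 :=
    Measure.quasiMeasurePreserving_snd.ae hgle
  have hVi : Integrable (fun q : ℝ × X × E × (Fin m → ℝ) => energyVariance P s Φ v α q.1 q.2)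
      (ν.prod μ) := by
    refine (hg.comp_snd ν).mono' (h.measurable_energyVariance α).aestronglyMeasurable ?_
    filter_upwards [hfst, hsnd] with q h1 h2
    rw [norm_of_nonneg (energyVariance_nonneg q.2)]
    exact h2 _ h1
  have hNi : Integrable (fun q : ℝ × X × E × (Fin m → ℝ) =>
      noiseMean P s Φ v α q.1 q.2 / (4 * q.1 * √q.1)) (ν.prod μ) := by
    have hN := (((memLp_sum_abs_noise P γ m).integrable one_le_two).const_mul √c).const_mul √α
    refine ((hN.div_const (4 * a * √a)).comp_snd ν).mono'
      ((h.measurable_noiseMean α).div (by fun_prop)).aestronglyMeasurable ?_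
    filter_upwards [hfst] with q hq
    have hq0 := ha.trans_le hq
    rw [norm_eq_abs, abs_div, abs_of_pos (a := 4 * q.1 * √q.1) (by positivity)]
    have := h.abs_noiseMean_le (α := α) (R := q.1) q.2
    gcongr
  set D : ℝ → X × E × (Fin m → ℝ) → ℝ := fun R ω =>
    energyVariance P s Φ v α R ω - noiseMean P s Φ v α R ω / (4 * R * √R) with hD
  have hDi : Integrable (Function.uncurry D) (ν.prod μ) := hVi.sub hNi
  have hDω : ∀ᵐ ω ∂μ, ∫ R in a..b, D R ω =
      energyMean P s Φ v α a ω - energyMean P s Φ v α b ω := by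
    filter_upwards [hDi.prod_left_ae] with ω hω
    have hDR : IntervalIntegrable (fun R => D R ω) volume a b := by
      rw [intervalIntegrable_iff]; exact hω
    have := intervalIntegral.integral_eq_sub_of_hasDerivAt
      (fun R hR => h.hasDerivAt_energyMean ω (hpos hR)) hDR.neg
    rw [intervalIntegral.integral_neg] at this
    linarith
  have hswap : ∫ R in a..b, ∫ ω, D R ω ∂μ ≤ α * c / 2 := by
    rw [intervalIntegral_integral_swap hDi, integral_congr_ae hDω, integral_sub
      (h.integrable_energyMean α a) (h.integrable_energyMean α b), h.integral_energyMean hα ha,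
      h.integral_energyMean hα (ha.trans_le hab)]
    have h1 := h.posterior_overlap_nonneg (γ := γ) hα ha.le
    have h2 := h.posterior_overlap_le (γ := γ) α b
    nlinarith
  have hle : ∀ R ∈ Icc a b, ∫ ω, energyVariance P s Φ v α R ω ∂μ ≤
      ∫ ω, D R ω ∂μ + α * c / 4 * R⁻¹ := fun R hR => by
    have hR0 := ha.trans_le hR.1
    have h1 := h.posterior_overlap_nonneg (γ := γ) hα hR0.le
    rw [integral_sub (h.integrable_energyVariance hα hR0)
      ((h.integrable_noiseMean α R).div_const _), integral_div, h.integral_noiseMean hα hR0.le]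
    have h2 : √R ≠ 0 := (sqrt_pos.2 hR0).ne'
    rw [sub_add, sub_eq_add_neg]
    refine le_add_of_nonneg_right ?_
    rw [neg_sub, sub_nonneg, mul_right_comm α, mul_div_mul_right _ _ h2, ← div_eq_mul_inv,
      div_div]
    gcongr
    linarith
  have hVint : IntervalIntegrable (fun R => ∫ ω, energyVariance P s Φ v α R ω ∂μ) volume a b := by
    rw [intervalIntegrable_iff]; exact hVi.integral_prod_left
  have hDint : IntervalIntegrable (fun R => ∫ ω, D R ω ∂μ) volume a b := by
    rw [intervalIntegrable_iff]; exact hDi.integral_prod_left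
  have hinv : IntervalIntegrable (fun R : ℝ => α * c / 4 * R⁻¹) volume a b :=
    (intervalIntegral.intervalIntegrable_inv (fun R hR => (hpos hR).ne')
      continuousOn_id).const_mul _
  refine (intervalIntegral.integral_mono_on hab hVint (hDint.add hinv) hle).trans ?_
  rw [intervalIntegral.integral_add hDint hinv, intervalIntegral.integral_const_mul,
    integral_inv_of_pos ha (ha.trans_le hab)]
  gcongr

end IsSphericalModel

end EnergyVariance

instance (p q : ℕ) : IsProbabilityMeasure (stdGaussianMat p q) := by
  unfold stdGaussianMat; infer_instance

/-- The signal received through the rank-one channel and the side channel of its first factor. -/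
def rankOneSignal {p q : ℕ} (l k : ℝ) (x : (Fin p → ℝ) × (Fin q → ℝ)) :
    (Fin p → Fin q → ℝ) × (Fin p → ℝ) :=
  (fun i j => l * x.1 i * x.2 j, fun i => k * x.1 i)

/-- The log-likelihood of the rank-one channel and the side channel of its first factor. -/
def rankOneLogLikelihood {p q : ℕ} (l k : ℝ) (y : (Fin p → Fin q → ℝ) × (Fin p → ℝ))
    (x : (Fin p → ℝ) × (Fin q → ℝ)) : ℝ :=
  ∑ i, ∑ j, (l * x.1 i * x.2 j * y.1 i j - (l * x.1 i * x.2 j) ^ 2 / 2) +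
    ∑ i, (k * x.1 i * y.2 i - (k * x.1 i) ^ 2 / 2)

section RankOne

variable {p q : ℕ} {P : Measure (Fin p → ℝ)} {Q : Measure (Fin q → ℝ)}

lemma abs_mul_sub_sq_le {a A : ℝ} (ha : |a| ≤ A) (y : ℝ) :
    |a * y - a ^ 2 / 2| ≤ A * |y| + A ^ 2 / 2 := by
  refine (abs_sub _ _).trans ?_
  rw [abs_mul, abs_of_nonneg (a := a ^ 2 / 2) (by positivity), ← sq_abs a]
  gcongr

lemma isSphericalModel_rankOne {c d : ℝ} (hP : ∀ᵐ u ∂P, ∑ i, u i ^ 2 = d)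
    (hQ : ∀ᵐ v ∂Q, ∑ j, v j ^ 2 = c) (l k : ℝ) :
    IsSphericalModel (P.prod Q) ((stdGaussianMat p q).prod (stdGaussian p)) (rankOneSignal l k)
      (rankOneLogLikelihood l k) Prod.snd c where
  measurable_shift := by unfold rankOneSignal; fun_prop
  measurable_logDensity := by
    simp only [Function.uncurry_def, rankOneLogLikelihood]; fun_prop
  bdd y := by
    refine ⟨∑ i, ∑ j, (|l| * √d * √c * |y.1 i j| + (|l| * √d * √c) ^ 2 / 2) +
      ∑ i, (|k| * √d * |y.2 i| + (|k| * √d) ^ 2 / 2), ?_⟩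
    filter_upwards [Measure.quasiMeasurePreserving_fst.ae hP,
      Measure.quasiMeasurePreserving_snd.ae hQ] with x hu hv
    refine (abs_add_le _ _).trans (add_le_add ?_ ?_)
    · refine (Finset.abs_sum_le_sum_abs _ _).trans (Finset.sum_le_sum fun i _ => ?_)
      refine (Finset.abs_sum_le_sum_abs _ _).trans (Finset.sum_le_sum fun j _ => ?_)
      refine abs_mul_sub_sq_le ?_ _
      rw [abs_mul, abs_mul]
      have := abs_le_sqrt_of_sum_sq hu i
      have := abs_le_sqrt_of_sum_sq hv j
      gcongr
    · refine (Finset.abs_sum_le_sum_abs _ _).trans (Finset.sum_le_sum fun i _ => ?_)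
      refine abs_mul_sub_sq_le ?_ _
      rw [abs_mul]
      have := abs_le_sqrt_of_sum_sq hu i
      gcongr
  shift x := by
    refine HasShiftLogDensity.prod
      (HasShiftLogDensity.pi fun i => HasShiftLogDensity.pi fun j =>
        hasShiftLogDensity_gaussianReal (l * x.1 i * x.2 j))
      (HasShiftLogDensity.pi fun i => hasShiftLogDensity_gaussianReal (k * x.1 i))
  measurable_signal := measurable_snd
  sum_sq := Measure.quasiMeasurePreserving_snd.ae hQ

lemma neg_interpH_eq {n : ℕ} {au av t Ru Rv : ℝ} (hau : 0 ≤ au) (hav : 0 ≤ av) (ht : t ≤ 1)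
    (hRu : 0 ≤ Ru) (hRv : 0 ≤ Rv) (ω : ((Fin p → ℝ) × (Fin q → ℝ)) ×
      ((Fin p → Fin q → ℝ) × (Fin p → ℝ)) × (Fin q → ℝ)) (x : (Fin p → ℝ) × (Fin q → ℝ)) :
    -(interpH n p q au av t Ru Rv ω.1.1 ω.1.2 ω.2.1.1 ω.2.1.2 ω.2.2 x.1 x.2) =
      logWeight (rankOneSignal √((1 - t) / n) √(av * Rv))
        (rankOneLogLikelihood √((1 - t) / n) √(av * Rv)) Prod.snd au Ru ω x := by
  have hl := sq_sqrt (div_nonneg (sub_nonneg.2 ht) (Nat.cast_nonneg n))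
  have hk := sq_sqrt (mul_nonneg hav hRv)
  rw [← logLikelihood_observation hau hRu]
  have hm := sq_sqrt (mul_nonneg hau hRu)
  simp only [interpH, logLikelihood, rankOneSignal, rankOneLogLikelihood, neg_add,
    ← Finset.sum_neg_distrib, Prod.fst_add, Prod.snd_add, Pi.add_apply]
  generalize √((1 - t) / n) = l at *
  generalize √(av * Rv) = k at *
  generalize √(au * Ru) = m at *
  refine congrArg₂ _ (congrArg₂ _ ?_ ?_) ?_
  · refine Finset.sum_congr rfl fun i _ => Finset.sum_congr rfl fun j _ => ?_
    rw [mul_comm (2 : ℝ), ← div_div, ← hl]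
    ring
  · refine Finset.sum_congr rfl fun i _ => ?_
    rw [← hk]
    ring
  · refine Finset.sum_congr rfl fun j _ => ?_
    rw [← hm]
    ring

variable [IsProbabilityMeasure P] [IsProbabilityMeasure Q]

lemma gibbs_eq_integral_tilted {n : ℕ} {au av t Ru Rv : ℝ} {U : Fin p → ℝ} {V : Fin q → ℝ}
    {Z : Fin p → Fin q → ℝ} {Zt : Fin p → ℝ} {Zb : Fin q → ℝ}
    {f : (Fin p → ℝ) → (Fin q → ℝ) → ℝ} {Ψ : (Fin p → ℝ) × (Fin q → ℝ) → ℝ}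
    (hΨ : ∀ x : (Fin p → ℝ) × (Fin q → ℝ),
      -(interpH n p q au av t Ru Rv U V Z Zt Zb x.1 x.2) = Ψ x)
    (hΨi : Integrable (fun x => exp (Ψ x)) (P.prod Q))
    (hf : Integrable (fun x => f x.1 x.2) ((P.prod Q).tilted Ψ)) :
    gibbs n p q au av t Ru Rv P Q U V Z Zt Zb f =
      ∫ x, f x.1 x.2 ∂((P.prod Q).tilted Ψ) := by
  have hΨ' : ∀ u v, -(interpH n p q au av t Ru Rv U V Z Zt Zb u v) = Ψ (u, v) :=
    fun u v => hΨ (u, v)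
  rw [integrable_tilted_iff hΨi] at hf
  simp only [smul_eq_mul, mul_comm (exp _)] at hf
  rw [integral_tilted_eq_div, integral_prod _ hf, integral_prod _ hΨi]
  simp only [gibbs, partFun, hΨ']

lemma Efull_eq_integral {F : ((Fin p → ℝ) × (Fin q → ℝ)) ×
      ((Fin p → Fin q → ℝ) × (Fin p → ℝ)) × (Fin q → ℝ) → ℝ}
    (hF : Integrable F
      ((P.prod Q).prod (((stdGaussianMat p q).prod (stdGaussian p)).prod (stdGaussian q)))) :
    Efull p q P Q (fun U V Z Zt Zb => F ((U, V), (Z, Zt), Zb)) =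
      ∫ ω, F ω
        ∂((P.prod Q).prod (((stdGaussianMat p q).prod (stdGaussian p)).prod (stdGaussian q))) := by
  rw [integral_prod _ hF, integral_prod _ hF.integral_prod_left]
  unfold Efull
  refine integral_congr_ae ?_
  filter_upwards [Measure.ae_ae_of_ae_prod hF.prod_right_ae] with U hU
  refine integral_congr_ae ?_
  filter_upwards [hU] with V hV
  rw [integral_prod _ hV, integral_prod _ hV.integral_prod_left]

lemma calL_eq_sideEnergy {n : ℕ} {au Ru : ℝ} (hau : 0 ≤ au) (ω : ((Fin p → ℝ) × (Fin q → ℝ)) ×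
      ((Fin p → Fin q → ℝ) × (Fin p → ℝ)) × (Fin q → ℝ)) (x : (Fin p → ℝ) × (Fin q → ℝ)) :
    calL n q au Ru x.2 ω.1.2 ω.2.2 = 1 / n * sideEnergy Prod.snd au Ru ω x := by
  unfold calL sideEnergy linearEnergy noiseEnergy
  congr 1
  rw [sqrt_div hau]
  simp only [Finset.mul_sum, Finset.sum_div, ← Finset.sum_sub_distrib]
  exact Finset.sum_congr rfl fun j _ => by ring

lemma thermalVarL_eq {n : ℕ} {c d au av t Ru Rv : ℝ} (hP : ∀ᵐ u ∂P, ∑ i, u i ^ 2 = d)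
    (hQ : ∀ᵐ v ∂Q, ∑ j, v j ^ 2 = c) (hau : 0 ≤ au) (hav : 0 ≤ av) (ht : t ≤ 1)
    (hRu : 0 < Ru) (hRv : 0 ≤ Rv) :
    thermalVarL n p q au av t Ru Rv P Q = (1 / n) ^ 2 *
      ∫ ω, energyVariance (P.prod Q) (rankOneSignal √((1 - t) / n) √(av * Rv))
        (rankOneLogLikelihood √((1 - t) / n) √(av * Rv)) Prod.snd au Ru ω
        ∂((P.prod Q).prod (((stdGaussianMat p q).prod (stdGaussian p)).prod (stdGaussian q))) := by
  have h := isSphericalModel_rankOne hP hQ √((1 - t) / n) √(av * Rv)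
  have hH := neg_interpH_eq (p := p) (q := q) (n := n) hau hav ht hRu.le hRv
  generalize rankOneSignal √((1 - t) / n) √(av * Rv) = s at *
  generalize rankOneLogLikelihood √((1 - t) / n) √(av * Rv) = Φ at *
  have hi := fun ω => integrable_exp_of_bdd (h.measurable_logWeight_right au Ru ω)
    (h.bdd_logWeight ω)
  have hbdd : ∀ ω : ((Fin p → ℝ) × (Fin q → ℝ)) ×
      ((Fin p → Fin q → ℝ) × (Fin p → ℝ)) × (Fin q → ℝ), ∀ b : ℝ,
      ∃ C, ∀ᵐ x ∂(P.prod Q), |1 / n * sideEnergy Prod.snd au Ru ω x - b| ≤ C := fun ω b => by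
    obtain ⟨C, hC⟩ := h.bdd_linearEnergy (α := au) ω.1.2
    refine ⟨1 / n * (C + √au * (√c * ∑ j, |ω.2.2 j|) / (2 * √Ru)) + |b|, ?_⟩
    filter_upwards [hC, h.abs_noiseEnergy_le (α := au) ω.2.2] with x h1 h2
    refine (abs_sub _ _).trans ?_
    rw [abs_mul, abs_of_nonneg (a := 1 / (n : ℝ)) (by positivity)]
    gcongr
    refine (abs_sub _ _).trans (add_le_add h1 ?_)
    rw [abs_div, abs_of_nonneg (a := 2 * √Ru) (by positivity)]
    gcongr
  have hmeas : ∀ ω : ((Fin p → ℝ) × (Fin q → ℝ)) ×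
      ((Fin p → Fin q → ℝ) × (Fin p → ℝ)) × (Fin q → ℝ), ∀ b : ℝ,
      Measurable fun x => 1 / n * sideEnergy Prod.snd au Ru ω x - b := fun ω b => by
    unfold sideEnergy linearEnergy noiseEnergy
    fun_prop
  have hmean : ∀ ω : ((Fin p → ℝ) × (Fin q → ℝ)) ×
      ((Fin p → Fin q → ℝ) × (Fin p → ℝ)) × (Fin q → ℝ),
      gibbs n p q au av t Ru Rv P Q ω.1.1 ω.1.2 ω.2.1.1 ω.2.1.2 ω.2.2
        (fun _ v' => calL n q au Ru v' ω.1.2 ω.2.2) =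
      1 / n * energyMean (P.prod Q) s Φ Prod.snd au Ru ω := fun ω => by
    rw [gibbs_eq_integral_tilted (hH ω) (hi ω)]
    · simp only [calL_eq_sideEnergy hau, integral_const_mul, energyMean]
    · simp only [calL_eq_sideEnergy hau]
      have := h.integrable_tilted (α := au) (R := Ru) ω (hmeas ω 0) (hbdd ω 0)
      simpa only [sub_zero] using this
  have hvar : ∀ ω : ((Fin p → ℝ) × (Fin q → ℝ)) ×
      ((Fin p → Fin q → ℝ) × (Fin p → ℝ)) × (Fin q → ℝ),
      gibbs n p q au av t Ru Rv P Q ω.1.1 ω.1.2 ω.2.1.1 ω.2.1.2 ω.2.2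
        (fun _ v => (calL n q au Ru v ω.1.2 ω.2.2 -
          gibbs n p q au av t Ru Rv P Q ω.1.1 ω.1.2 ω.2.1.1 ω.2.1.2 ω.2.2
            (fun _ v' => calL n q au Ru v' ω.1.2 ω.2.2)) ^ 2) =
      (1 / n) ^ 2 * energyVariance (P.prod Q) s Φ Prod.snd au Ru ω := fun ω => by
    rw [hmean, gibbs_eq_integral_tilted (hH ω) (hi ω)]
    · simp only [calL_eq_sideEnergy hau, ← mul_sub, mul_pow, integral_const_mul, energyVariance]
    · simp only [calL_eq_sideEnergy hau]
      refine h.integrable_tilted ω ((hmeas ω _).pow_const 2) ?_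
      obtain ⟨C, hC⟩ := hbdd ω (1 / n * energyMean (P.prod Q) s Φ Prod.snd au Ru ω)
      refine ⟨C ^ 2, hC.mono fun x hx => ?_⟩
      rw [abs_pow]
      gcongr
  rw [← integral_const_mul, ← Efull_eq_integral ((h.integrable_energyVariance hau hRu).const_mul _)]
  unfold thermalVarL
  simp only [← hvar]

end RankOne

/-- **Proposition: thermal fluctuations of `𝓛`.** For `n` large
enough, for all `0 < a < b`, all `t ∈ [0,1]` and all `R_v ∈ [0,∞)`:
`∫_a^b E⟨(𝓛 − ⟨𝓛⟩)²⟩ dR_u ≤ (α_uα_vρ_v/n)(ln(b/a)/2 + 1)`. -/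
theorem thermal_fluctuations_calL
    (au av ru rv : ℝ) (hau : 0 < au) (hav : 0 < av) (hru : 0 < ru) (hrv : 0 < rv)
    (nuf nvf : ℕ → ℕ)
    (hnuf : Tendsto (fun n => (nuf n : ℝ) / n) atTop (nhds au))
    (hnvf : Tendsto (fun n => (nvf n : ℝ) / n) atTop (nhds av))
    (Pu : (n : ℕ) → Measure (Fin (nuf n) → ℝ))
    (Pv : (n : ℕ) → Measure (Fin (nvf n) → ℝ))
    (hPu : ∀ n, IsUniformSphere (nuf n) (Real.sqrt (ru * nuf n)) (Pu n))
    (hPv : ∀ n, IsUniformSphere (nvf n) (Real.sqrt (rv * nvf n)) (Pv n)) :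
    ∃ N : ℕ, ∀ n : ℕ, N ≤ n →
      ∀ a b : ℝ, 0 < a → a < b → ∀ t ∈ Icc (0:ℝ) 1, ∀ Rv : ℝ, 0 ≤ Rv →
        (∫ Ru in a..b, thermalVarL n (nuf n) (nvf n) au av t Ru Rv (Pu n) (Pv n))
          ≤ (au * av * rv / n) * (Real.log (b / a) / 2 + 1) := by
  have hev : ∀ᶠ n : ℕ in atTop, (nvf n : ℝ) / n < 2 * av :=
    hnvf.eventually_lt_const (by linarith)
  obtain ⟨N, hN⟩ := eventually_atTop.1 (hev.and (eventually_gt_atTop 0))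
  refine ⟨N, fun n hn a b ha hab t ht Rv hRv => ?_⟩
  obtain ⟨hratio, hn0⟩ := hN n hn
  have hn0' : (0 : ℝ) < n := Nat.cast_pos.2 hn0
  rw [div_lt_iff₀ hn0'] at hratio
  have := (hPu n).1
  have := (hPv n).1
  have hP := (hPu n).2.1
  have hQ := (hPv n).2.1
  rw [sq_sqrt (by positivity)] at hP hQ
  have hcongr : ∫ Ru in a..b, thermalVarL n (nuf n) (nvf n) au av t Ru Rv (Pu n) (Pv n) =
      ∫ Ru in a..b, (1 / (n : ℝ)) ^ 2 * ∫ ω, energyVariance ((Pu n).prod (Pv n))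
        (rankOneSignal √((1 - t) / n) √(av * Rv))
        (rankOneLogLikelihood √((1 - t) / n) √(av * Rv)) Prod.snd au Ru ω
        ∂(((Pu n).prod (Pv n)).prod
          (((stdGaussianMat (nuf n) (nvf n)).prod (stdGaussian (nuf n))).prod
            (stdGaussian (nvf n)))) := by
    refine intervalIntegral.integral_congr fun Ru hRu => ?_
    rw [uIcc_of_le hab.le] at hRu
    exact thermalVarL_eq hP hQ hau.le hav.le ht.2 (ha.trans_le hRu.1) hRv
  rw [hcongr, intervalIntegral.integral_const_mul]
  have hmain := (isSphericalModel_rankOne hP hQ √((1 - t) / n)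
    √(av * Rv)).intervalIntegral_energyVariance_le hau.le ha hab.le
  have hlog : 0 ≤ log (b / a) := log_nonneg ((one_le_div ha).2 hab.le)
  calc _ ≤ (1 / (n : ℝ)) ^ 2 * (au * (rv * nvf n) / 2 + au * (rv * nvf n) / 4 * log (b / a)) := by
        gcongr
    _ = (1 / (n : ℝ)) ^ 2 * (au * rv / 2 * (log (b / a) / 2 + 1)) * nvf n := by ring
    _ ≤ (1 / (n : ℝ)) ^ 2 * (au * rv / 2 * (log (b / a) / 2 + 1)) * (2 * av * n) := by gcongr
    _ = _ := by field_simp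

end
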